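/- arXiv:1008.3015 — 4 statements merged into one kernel-verified Lean document; each statement's English description precedes it below -/
import Mathlib

section
/- There is a constant c > 0 such that for all integers m ≥ 2 and n ≥ max(m,3), the multiplexor partial function Mux_m : S^{2m} ⇀ S — defined exactly on pairs (v,u) with v ∈ S^m and u ∈ S^m equal to a 0-1 vector with a single 1 in some position i, with value Mux_m(v,u) = v_i — can be simulated through n-colorings by a finite simple graph with at most c·n⁴ vertices and at most c·n⁵ edges. -/
/-- A proper `n`-coloring of a simple graph: adjacent vertices get different colors. -/
def IsProperColoring {V : Type} (G : SimpleGraph V) {n : ℕ} (σ : V → Fin n) : Prop :=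
  ∀ ⦃u v : V⦄, G.Adj u v → σ u ≠ σ v

/-- The graph `G`, with input vertices `x`, output vertices `y` and reference vertices `r`,
simulates the partial function `φ : S^p ⇀ S^q` (encoded via `Option`) through `n`-colorings,
where `S = {0,…,m-1}` is identified with the first `m` colors of `C = {0,…,n-1}`. -/
def Simulates {V : Type} (G : SimpleGraph V) (m n : ℕ) {p q : ℕ}
    (φ : (Fin p → Fin m) → Option (Fin q → Fin m))
    (x : Fin p → V) (y : Fin q → V) (r : Fin n → V) : Prop :=
  Function.Injective r ∧
  (∃ σ : V → Fin n, IsProperColoring G σ) ∧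
  (∀ σ : V → Fin n, IsProperColoring G σ → Function.Injective fun i => σ (r i)) ∧
  ∀ a : Fin p → Fin n,
    ((∃ σ : V → Fin n, IsProperColoring G σ ∧ (∀ i, σ (r i) = i) ∧ ∀ j, σ (x j) = a j) ↔
      ∃ a' : Fin p → Fin m, (∀ j, (a j : ℕ) = (a' j : ℕ)) ∧ (φ a').isSome) ∧
    (∀ σ τ : V → Fin n, IsProperColoring G σ → IsProperColoring G τ →
      (∀ i, σ (r i) = i) → (∀ i, τ (r i) = i) →
      (∀ j, σ (x j) = a j) → (∀ j, τ (x j) = a j) → σ = τ) ∧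
    (∀ σ : V → Fin n, IsProperColoring G σ → (∀ i, σ (r i) = i) → (∀ j, σ (x j) = a j) →
      ∀ (a' : Fin p → Fin m) (b : Fin q → Fin m),
        (∀ j, (a j : ℕ) = (a' j : ℕ)) → φ a' = some b →
        ∀ k, (σ (y k) : ℕ) = (b k : ℕ))

/-- A list-coloring gadget with auxiliary vertices `A`, attached to two terminals. -/
structure Gadget (n : ℕ) (A : Type) where
  /-- The colors allowed at an auxiliary vertex. -/
  list : A → Set (Fin n)
  /-- The auxiliary vertices adjacent to the first terminal. -/
  left : A → Prop
  /-- The auxiliary vertices adjacent to the second terminal. -/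
  right : A → Prop
  /-- The edges between auxiliary vertices. -/
  rel : A → A → Prop

/-- `f` properly colors the auxiliary vertices when the terminals have colors `x` and `y`. -/
def Gadget.Valid {n : ℕ} {A : Type} (g : Gadget n A) (x y : Fin n) (f : A → Fin n) : Prop :=
  (∀ t, f t ∈ g.list t) ∧ (∀ t, g.left t → x ≠ f t) ∧ (∀ t, g.right t → y ≠ f t) ∧
    ∀ t t', t ≠ t' → g.rel t t' → f t ≠ f t'

/-- The auxiliary vertices of the gadgets used below: two indicator cliques and two more. -/
abbrev Aux (n : ℕ) : Type := Fin n ⊕ Fin n ⊕ Bool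

/-- A clique on the vertices `k ≠ s` with lists `{k, s}`, joined to a vertex colored `x`,
has exactly one coloring: `k` receives `s` if `k = x`, and `k` otherwise. -/
theorem indicator_iff {n : ℕ} (s x : Fin n) (f : Fin n → Fin n) :
    ((∀ k, f k = k ∨ f k = s) ∧ (∀ k, k ≠ s → x ≠ f k) ∧
      ∀ k l, k ≠ l → k ≠ s → l ≠ s → f k ≠ f l) ↔ ∀ k, f k = if k = x then s else k := by
  constructor
  · rintro ⟨h1, h2, h3⟩ k
    have := h1 k
    have := h1 x
    have := h2 k
    have := h2 x
    have := h3 k x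
    grind
  · intro h
    refine ⟨?_, ?_, ?_⟩
    · intro k; rw [h]; grind
    · intro k; rw [h]; grind
    · intro k l; rw [h, h]; grind

theorem exists_gadget_of_ne {n : ℕ} {a b s : Fin n} (hab : a ≠ b) (hsa : s ≠ a) (hsb : s ≠ b) :
    ∃ (g : Gadget n (Aux n)) (F : Fin n → Fin n → Aux n → Fin n),
      ∀ x y f, g.Valid x y f ↔ f = F x y ∧ ¬(x = a ∧ y = b) := by
  refine ⟨⟨fun t => match t with
      | .inl k => {k, s}
      | .inr (.inl k) => {k, s}
      | .inr (.inr _) => {s},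
    fun t => match t with
      | .inl k => k ≠ s
      | _ => False,
    fun t => match t with
      | .inr (.inl k) => k ≠ s
      | _ => False,
    fun t t' => match t, t' with
      | .inl k, .inl l => k ≠ s ∧ l ≠ s
      | .inr (.inl k), .inr (.inl l) => k ≠ s ∧ l ≠ s
      | .inl k, .inr (.inl l) => k = a ∧ l = b
      | _, _ => False⟩,
    fun x y t => match t with
      | .inl k => if k = x then s else k
      | .inr (.inl k) => if k = y then s else k
      | .inr (.inr _) => s, fun x y f => ?_⟩
  have hx := indicator_iff s x (fun k => f (.inl k))
  have hy := indicator_iff s y (fun k => f (.inr (.inl k)))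
  simp only [Gadget.Valid, funext_iff, Sum.forall, Bool.forall_bool, Set.mem_insert_iff,
    Set.mem_singleton_iff, ne_eq, Sum.inl.injEq, Sum.inr.injEq, reduceCtorEq, not_false_eq_true,
    false_imp_iff, true_imp_iff, imp_true_iff, and_true, true_and] at hx hy ⊢
  constructor
  · rintro ⟨⟨l1, l2, l3⟩, p1, p2, r1, r2⟩
    have ex := hx.1 ⟨l1, p1, fun k l h1 h2 h3 => (r1 k).1 l h1 ⟨h2, h3⟩⟩
    have ey := hy.1 ⟨l2, p2, fun k l h1 h2 h3 => r2 k l h1 ⟨h2, h3⟩⟩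
    refine ⟨⟨ex, ey, l3⟩, ?_⟩
    rintro ⟨rfl, rfl⟩
    exact (r1 x).2 y ⟨rfl, rfl⟩ (by rw [ex, ey]; simp)
  · rintro ⟨⟨ex, ey, l3⟩, h⟩
    obtain ⟨l1, p1, q1⟩ := hx.2 ex
    obtain ⟨l2, p2, q2⟩ := hy.2 ey
    refine ⟨⟨l1, l2, l3⟩, p1, p2, fun k => ⟨fun l h1 h2 => q1 k l h1 h2.1 h2.2, ?_⟩,
      fun k l h1 h2 => q2 k l h1 h2.1 h2.2⟩
    rintro l ⟨rfl, rfl⟩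
    rw [ex, ey]
    grind

theorem exists_gadget_self {n : ℕ} {a s t : Fin n} (hsa : s ≠ a) (hta : t ≠ a) (hst : s ≠ t) :
    ∃ (g : Gadget n (Aux n)) (F : Fin n → Fin n → Aux n → Fin n),
      ∀ x y f, g.Valid x y f ↔ f = F x y ∧ ¬(x = a ∧ y = a) := by
  refine ⟨⟨fun t' => match t' with
      | .inl k => {k, s}
      | .inr (.inl k) => {k, t}
      | .inr (.inr true) => {s, t}
      | .inr (.inr false) => {a, t},
    fun t' => match t' with
      | .inl k => k ≠ s
      | _ => False,
    fun t' => match t' with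
      | .inr (.inl k) => k ≠ t
      | _ => False,
    fun t₁ t₂ => match t₁, t₂ with
      | .inl k, .inl l => k ≠ s ∧ l ≠ s
      | .inr (.inl k), .inr (.inl l) => k ≠ t ∧ l ≠ t
      | .inl k, .inr (.inr _) => k = a
      | .inr (.inr true), .inr (.inr false) => True
      | .inr (.inl k), .inr (.inr true) => k = a
      | _, _ => False⟩,
    fun x y t' => match t' with
      | .inl k => if k = x then s else k
      | .inr (.inl k) => if k = y then t else k
      | .inr (.inr true) => if x = a then t else s
      | .inr (.inr false) => if x = a then a else t, fun x y f => ?_⟩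
  have hx := indicator_iff s x (fun k => f (.inl k))
  have hy := indicator_iff t y (fun k => f (.inr (.inl k)))
  simp only [Gadget.Valid, funext_iff, Sum.forall, Bool.forall_bool, Set.mem_insert_iff,
    Set.mem_singleton_iff, ne_eq, Sum.inl.injEq, Sum.inr.injEq, reduceCtorEq, not_false_eq_true,
    false_imp_iff, true_imp_iff, imp_true_iff, and_true, true_and] at hx hy ⊢
  constructor
  · rintro ⟨⟨l1, l2, l3, l4⟩, p1, p2, r1, r2, r3⟩
    have ex := hx.1 ⟨l1, p1, fun k l h1 h2 h3 => (r1 k).1 l h1 ⟨h2, h3⟩⟩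
    have ey := hy.1 ⟨l2, p2, fun k l h1 h2 h3 => (r2 k).1 l h1 ⟨h2, h3⟩⟩
    have exa := ex a
    have eya := ey a
    have ra := (r1 a).2
    have rb := (r2 a).2
    refine ⟨⟨ex, ey, ?_, ?_⟩, ?_⟩ <;> grind
  · rintro ⟨⟨ex, ey, l3, l4⟩, h⟩
    obtain ⟨l1, p1, q1⟩ := hx.2 ex
    obtain ⟨l2, p2, q2⟩ := hy.2 ey
    have exa := ex a
    have eya := ey a
    refine ⟨⟨l1, l2, by grind, by grind⟩, p1, p2,
      fun k => ⟨fun l h1 h2 => q1 k l h1 h2.1 h2.2, ?_⟩,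
      fun k => ⟨fun l h1 h2 => q2 k l h1 h2.1 h2.2, ?_⟩, ?_⟩ <;> grind

/-- For every pair of colors there is a gadget that can be colored exactly when the terminals
do not carry this pair, and then in a unique way. -/
theorem exists_gadget {n : ℕ} (hn : 3 ≤ n) (a b : Fin n) :
    ∃ (g : Gadget n (Aux n)) (F : Fin n → Fin n → Aux n → Fin n),
      ∀ x y f, g.Valid x y f ↔ f = F x y ∧ ¬(x = a ∧ y = b) := by
  have key : ∀ a b : Fin n, ∃ s, s ≠ a ∧ s ≠ b := by
    intro a b
    have : ({a, b} : Finset (Fin n)).card < (Finset.univ : Finset (Fin n)).card := by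
      have := Finset.card_le_two (a := a) (b := b)
      simp only [Finset.card_univ, Fintype.card_fin]
      omega
    obtain ⟨s, -, hs⟩ := Finset.exists_mem_notMem_of_card_lt_card this
    exact ⟨s, by simpa using hs⟩
  by_cases hab : a = b
  · subst hab
    obtain ⟨s, hs, -⟩ := key a a
    obtain ⟨t, ht, hst⟩ := key a s
    exact exists_gadget_self hs ht hst.symm
  · obtain ⟨s, h1, h2⟩ := key a b
    exact exists_gadget_of_ne hab h1 h2

section Network

variable {n : ℕ} {I E A : Type} (L : I → Set (Fin n)) (p q : E → I) (g : E → Gadget n A)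

/-- Adjacency, up to symmetry, in the graph made of a reference clique, of variables `I` with
color lists `L`, and, for each `e : E`, of a gadget attached to the variables `p e` and `q e`. -/
def networkRel : Fin n ⊕ I ⊕ E × A → Fin n ⊕ I ⊕ E × A → Prop
  | .inl _, .inl _ => True
  | .inl c, .inr (.inl x) => c ∉ L x
  | .inl c, .inr (.inr t) => c ∉ (g t.1).list t.2
  | .inr (.inl x), .inr (.inr t) => (x = p t.1 ∧ (g t.1).left t.2) ∨ (x = q t.1 ∧ (g t.1).right t.2)
  | .inr (.inr t), .inr (.inr t') => t.1 = t'.1 ∧ (g t.1).rel t.2 t'.2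
  | _, _ => False

/-- The graph with adjacency `networkRel`. -/
def network : SimpleGraph (Fin n ⊕ I ⊕ E × A) := SimpleGraph.fromRel (networkRel L p q g)

theorem isProperColoring_network_iff {σ : Fin n ⊕ I ⊕ E × A → Fin n} (hσ : ∀ i, σ (.inl i) = i) :
    IsProperColoring (network L p q g) σ ↔ (∀ x, σ (.inr (.inl x)) ∈ L x) ∧
      ∀ e, (g e).Valid (σ (.inr (.inl (p e)))) (σ (.inr (.inl (q e))))
        fun t => σ (.inr (.inr (e, t))) := by
  have h0 : IsProperColoring (network L p q g) σ ↔
      ∀ u v, u ≠ v → networkRel L p q g u v → σ u ≠ σ v := by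
    constructor
    · intro h u v huv hr
      exact h ((SimpleGraph.fromRel_adj _ _ _).2 ⟨huv, .inl hr⟩)
    · intro h u v huv
      obtain ⟨huv, hr | hr⟩ := (SimpleGraph.fromRel_adj _ _ _).1 huv
      · exact h u v huv hr
      · exact (h v u huv.symm hr).symm
  rw [h0]
  constructor
  · intro h
    refine ⟨fun x => ?_, fun e => ⟨fun t => ?_, fun t ht => ?_, fun t ht => ?_,
      fun t t' htt ht => ?_⟩⟩
    · by_contra hx
      exact h (.inl (σ (.inr (.inl x)))) (.inr (.inl x)) (by simp) hx (hσ _)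
    · by_contra hx
      exact h (.inl (σ (.inr (.inr (e, t))))) (.inr (.inr (e, t))) (by simp) hx (hσ _)
    · exact h (.inr (.inl (p e))) (.inr (.inr (e, t))) (by simp) (.inl ⟨rfl, ht⟩)
    · exact h (.inr (.inl (q e))) (.inr (.inr (e, t))) (by simp) (.inr ⟨rfl, ht⟩)
    · exact h (.inr (.inr (e, t))) (.inr (.inr (e, t'))) (by simpa using htt) ⟨rfl, ht⟩
  · rintro ⟨hL, hV⟩ (i | x | ⟨e, t⟩) (j | x' | ⟨e', t'⟩) huv hr <;> try exact hr.elim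
    · rw [hσ, hσ]; simpa using huv
    · rw [hσ]; rintro rfl; exact hr (hL _)
    · rw [hσ]; rintro rfl; exact hr ((hV e').1 _)
    · rcases hr with ⟨rfl, hr⟩ | ⟨rfl, hr⟩
      · exact (hV e').2.1 _ hr
      · exact (hV e').2.2.1 _ hr
    · obtain ⟨rfl, hr⟩ := hr
      exact (hV e).2.2.2 t t' (by simpa using huv) hr

theorem network_refs_injective {σ : Fin n ⊕ I ⊕ E × A → Fin n}
    (h : IsProperColoring (network L p q g) σ) : Function.Injective fun i => σ (.inl i) := by
  intro i j hij
  by_contra hne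
  exact h (u := .inl i) (v := .inl j)
    ((SimpleGraph.fromRel_adj _ _ _).2 ⟨by simpa using hne, .inl trivial⟩) hij

theorem card_edgeSet_network_le [Fintype I] [Fintype E] [Fintype A] :
    Nat.card (network L p q g).edgeSet ≤
      n * (n + (Fintype.card I + Fintype.card E * Fintype.card A)) +
        (Fintype.card E * Fintype.card A * 2 + Fintype.card E * Fintype.card A * Fintype.card A) := by
  let T := Fin n × (Fin n ⊕ I ⊕ E × A) ⊕ (E × A) × Bool ⊕ (E × A) × A
  let φ : T → Sym2 (Fin n ⊕ I ⊕ E × A) := fun t => match t with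
    | .inl (c, v) => s(.inl c, v)
    | .inr (.inl (t, true)) => s(.inr (.inl (p t.1)), .inr (.inr t))
    | .inr (.inl (t, false)) => s(.inr (.inl (q t.1)), .inr (.inr t))
    | .inr (.inr (t, t')) => s(.inr (.inr t), .inr (.inr (t.1, t')))
  have key : ∀ u v, networkRel L p q g u v → s(u, v) ∈ Set.range φ := by
    rintro (i | x | ⟨e, t⟩) (j | x' | ⟨e', t'⟩) hr <;> try exact hr.elim
    · exact ⟨.inl (_, _), rfl⟩
    · exact ⟨.inl (_, _), rfl⟩
    · exact ⟨.inl (_, _), rfl⟩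
    · rcases hr with ⟨rfl, -⟩ | ⟨rfl, -⟩
      · exact ⟨.inr (.inl (_, true)), rfl⟩
      · exact ⟨.inr (.inl (_, false)), rfl⟩
    · obtain ⟨rfl, -⟩ := hr
      exact ⟨.inr (.inr (_, _)), rfl⟩
  have hsub : (network L p q g).edgeSet ⊆ Set.range φ := by
    intro z
    induction z with | h u v => ?_
    intro hz
    obtain ⟨-, hr | hr⟩ := (SimpleGraph.fromRel_adj _ _ _).1 hz
    · exact key u v hr
    · rw [Sym2.eq_swap]; exact key v u hr
  calc Nat.card (network L p q g).edgeSet ≤ Nat.card (Set.range φ) :=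
        Nat.card_mono (Set.toFinite _) hsub
    _ ≤ Nat.card T := Finite.card_range_le φ
    _ = _ := by simp [T, Nat.card_eq_fintype_card]

end Network

/-- Binary constraint satisfaction problems, each constraint forbidding one pair of values, are
expressible through uniquely extendable `n`-colorings. -/
theorem exists_graph_of_constraints {n : ℕ} (hn : 3 ≤ n) {I E : Type} [Fintype I] [Fintype E]
    (L : I → Set (Fin n)) (p q : E → I) (a b : E → Fin n) :
    ∃ (V : Type) (_ : Fintype V) (G : SimpleGraph V) (ι : I → V) (r : Fin n → V),
      Function.Injective r ∧
      (∀ σ : V → Fin n, IsProperColoring G σ → Function.Injective fun i => σ (r i)) ∧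
      (∀ τ : I → Fin n, (∃ σ : V → Fin n, IsProperColoring G σ ∧ (∀ i, σ (r i) = i) ∧
        ∀ x, σ (ι x) = τ x) ↔
          (∀ x, τ x ∈ L x) ∧ ∀ e, ¬(τ (p e) = a e ∧ τ (q e) = b e)) ∧
      (∀ σ σ' : V → Fin n, IsProperColoring G σ → IsProperColoring G σ' →
        (∀ i, σ (r i) = i) → (∀ i, σ' (r i) = i) → (∀ x, σ (ι x) = σ' (ι x)) → σ = σ') ∧
      Nat.card V = n + (Fintype.card I + Fintype.card E * (n + (n + 2))) ∧
      Nat.card G.edgeSet ≤ n * (n + (Fintype.card I + Fintype.card E * (n + (n + 2)))) +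
        (Fintype.card E * (n + (n + 2)) * 2 +
          Fintype.card E * (n + (n + 2)) * (n + (n + 2))) := by
  choose g F hF using fun e => exists_gadget hn (a e) (b e)
  refine ⟨Fin n ⊕ I ⊕ E × Aux n, inferInstance, network L p q g, fun x => .inr (.inl x), .inl,
    Sum.inl_injective, fun σ => network_refs_injective L p q g, fun τ => ⟨?_, ?_⟩, ?_, ?_, ?_⟩
  · rintro ⟨σ, hσ, hr, hτ⟩
    rw [isProperColoring_network_iff L p q g hr] at hσ
    simp only [hF, hτ] at hσ
    exact ⟨hσ.1, fun e => (hσ.2 e).2⟩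
  · rintro ⟨h1, h2⟩
    refine ⟨Sum.elim id (Sum.elim τ fun t => F t.1 (τ (p t.1)) (τ (q t.1)) t.2), ?_,
      fun i => rfl, fun x => rfl⟩
    rw [isProperColoring_network_iff L p q g fun i => rfl]
    exact ⟨h1, fun e => (hF e _ _ _).2 ⟨rfl, h2 e⟩⟩
  · intro σ σ' h h' hr hr' hx
    rw [isProperColoring_network_iff L p q g hr] at h
    rw [isProperColoring_network_iff L p q g hr'] at h'
    simp only [hF] at h h'
    funext v
    rcases v with i | x | ⟨e, t⟩
    · rw [hr, hr']
    · exact hx x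
    · have h1 := congrFun (h.2 e).1 t
      have h2 := congrFun (h'.2 e).1 t
      simp only [hx] at h1
      exact h1.trans h2.symm
  · simp [Nat.card_eq_fintype_card]
  · simpa using card_edgeSet_network_le L p q g

/-- The constraints defining the multiplexor: `s` selects the position of the single `1` in `u`,
and `w i k` is `0`, `1` or `2` according to whether `u i = 1` and `v i = k`, or `u i = 1` and
`v i ≠ k`, or `u i = 0`. -/
theorem mux_constraints_iff {m : ℕ} (v u : Fin m → ℕ) (w : Fin m → Fin m → ℕ) (y s : ℕ) :
    ((∀ i, v i < m) ∧ (∀ i, u i < 2) ∧ (∀ i k, w i k < 3) ∧ y < m ∧ s < m ∧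
      (∀ i j : Fin m, ¬(s = j ∧ u i = if i = j then 0 else 1)) ∧
      (∀ i k k' : Fin m, ¬(w i k = (if k' = k then 1 else 0) ∧ v i = k')) ∧
      (∀ i k k' : Fin m, ¬(w i k = 0 ∧ if k' = k then u i = 0 else y = k')) ∧
      (∀ i k, ¬(w i k = 1 ∧ u i = 0)) ∧ (∀ i k, ¬(w i k = 2 ∧ u i = 1))) ↔
    ∃ i : Fin m, s = i ∧ (∀ j, u j = if j = i then 1 else 0) ∧ (∀ j, v j < m) ∧ y = v i ∧
      ∀ j k : Fin m, w j k = if j = i then if v j = k then 0 else 1 else 2 := by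
  constructor
  · rintro ⟨hv, hu, hw, hy, hs, h1, h2, h3, h4, h5⟩
    obtain ⟨i, rfl⟩ : ∃ i : Fin m, s = i := ⟨⟨s, hs⟩, rfl⟩
    have hu' : ∀ j, u j = if j = i then 1 else 0 := by
      intro j
      have := h1 j i
      have := hu j
      grind
    have hw' : ∀ j k : Fin m, w j k = if j = i then if v j = k then 0 else 1 else 2 := by
      intro j k
      have e1 := hw j k
      have e2 := h2 j k ⟨v j, hv j⟩
      have e3 := h3 j k k
      have e4 := h4 j k
      have e5 := h5 j k
      have e6 := hu' j
      simp only [Fin.ext_iff] at e2 e3 e4 e5 e6 ⊢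
      grind
    refine ⟨i, rfl, hu', hv, ?_, hw'⟩
    have e1 := hw' i ⟨v i, hv _⟩
    have e2 := h3 i ⟨v i, hv _⟩ ⟨y, hy⟩
    simp only [Fin.ext_iff] at e1 e2
    by_contra hne
    simp only [if_true] at e1
    simp [hne, e1] at e2
  · rintro ⟨i, rfl, hu, hv, rfl, hw⟩
    refine ⟨hv, ?_, ?_, hv i, i.2, ?_, ?_, ?_, ?_, ?_⟩
    · intro j; rw [hu]; split_ifs <;> omega
    · intro j k; rw [hw]; split_ifs <;> omega
    · intro j k; rw [hu]; grind
    all_goals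
      intro j k
      try intro k'
      have e1 := hu j
      have e2 := hw j k
      grind

section Mux

variable {m : ℕ}

/-- The position of `v i` among the inputs of the multiplexor. -/
def muxValue (i : Fin m) : Fin (2 * m) := (i.castAdd m).cast (two_mul m).symm

/-- The position of `u i` among the inputs of the multiplexor. -/
def muxSelect (i : Fin m) : Fin (2 * m) := (i.natAdd m).cast (two_mul m).symm

theorem forall_muxInput {P : Fin (2 * m) → Prop} :
    (∀ j, P j) ↔ (∀ i : Fin m, P (muxValue i)) ∧ ∀ i : Fin m, P (muxSelect i) := by
  refine ⟨fun h => ⟨fun i => h _, fun i => h _⟩, fun ⟨h1, h2⟩ j => ?_⟩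
  by_cases hj : (j : ℕ) < m
  · exact h1 ⟨j, hj⟩
  · have := h2 ⟨j - m, by omega⟩
    convert this using 1
    simp only [muxSelect, Fin.ext_iff, Fin.val_cast, Fin.val_natAdd]
    omega

/-- Inputs, the auxiliary variables `w i k`, the output (`true`) and the selector (`false`). -/
abbrev MuxVar (m : ℕ) : Type := Fin (2 * m) ⊕ (Fin m × Fin m) ⊕ Bool

/-- `τ` is the assignment of the multiplexor variables whose selector is `i`. -/
def IsMuxAssignment {n : ℕ} (τ : MuxVar m → Fin n) (i : Fin m) : Prop :=
  (τ (.inr (.inr false)) : ℕ) = i ∧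
  (∀ j, (τ (.inl (muxSelect j)) : ℕ) = if j = i then 1 else 0) ∧
  (∀ j, (τ (.inl (muxValue j)) : ℕ) < m) ∧
  (τ (.inr (.inr true)) : ℕ) = τ (.inl (muxValue i)) ∧
  ∀ j k : Fin m, (τ (.inr (.inl (j, k))) : ℕ) =
    if j = i then if (τ (.inl (muxValue j)) : ℕ) = k then 0 else 1 else 2

theorem IsMuxAssignment.eq {n : ℕ} {τ τ' : MuxVar m → Fin n} {i i' : Fin m}
    (h : IsMuxAssignment τ i) (h' : IsMuxAssignment τ' i') (hin : ∀ j, τ (.inl j) = τ' (.inl j)) :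
    τ = τ' := by
  obtain ⟨h1, h2, h3, h4, h5⟩ := h
  obtain ⟨h1', h2', h3', h4', h5'⟩ := h'
  have hi : i = i' := by
    have e1 := h2 i
    have e2 := h2' i
    rw [hin] at e1
    grind
  subst hi
  funext x
  rcases x with j | ⟨j, k⟩ | (_ | _)
  · exact hin j
  · rw [Fin.ext_iff, h5, h5', hin]
  · rw [Fin.ext_iff, h1, h1']
  · rw [Fin.ext_iff, h4, h4', hin]

theorem exists_isMuxAssignment {n : ℕ} (hn : 3 ≤ n) (hmn : m ≤ n) (a : Fin (2 * m) → Fin n)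
    (i : Fin m) (hu : ∀ j, (a (muxSelect j) : ℕ) = if j = i then 1 else 0)
    (hv : ∀ j, (a (muxValue j) : ℕ) < m) :
    ∃ τ : MuxVar m → Fin n, IsMuxAssignment τ i ∧ ∀ j, τ (.inl j) = a j := by
  refine ⟨Sum.elim a (Sum.elim (fun jk => ⟨if jk.1 = i then
    if (a (muxValue jk.1) : ℕ) = jk.2 then 0 else 1 else 2, by split_ifs <;> omega⟩)
    fun b => if b then a (muxValue i) else Fin.castLE hmn i), ?_, fun j => rfl⟩
  exact ⟨by simp, hu, hv, by simp, fun j k => rfl⟩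

theorem exists_mux_constraints {n : ℕ} (hn : 3 ≤ n) (hmn : m ≤ n) :
    ∃ (E : Type) (_ : Fintype E) (L : MuxVar m → Set (Fin n)) (p q : E → MuxVar m)
      (a b : E → Fin n),
      Fintype.card E = m * m + (m * m * m + (m * m * m + m * m * 2)) ∧
      ∀ τ : MuxVar m → Fin n, ((∀ x, τ x ∈ L x) ∧ ∀ e, ¬(τ (p e) = a e ∧ τ (q e) = b e)) ↔
        ∃ i, IsMuxAssignment τ i := by
  let c : Fin 3 → Fin n := Fin.castLE hn
  let d : Fin m → Fin n := Fin.castLE hmn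
  let f : (Fin m × Fin m) ⊕ ((Fin m × Fin m) × Fin m) ⊕ ((Fin m × Fin m) × Fin m) ⊕
      ((Fin m × Fin m) × Bool) → (MuxVar m × Fin n) × (MuxVar m × Fin n) := fun e => match e with
    | .inl (i, j) => ((.inr (.inr false), d j), (.inl (muxSelect i), if i = j then c 0 else c 1))
    | .inr (.inl (ik, k')) => ((.inr (.inl ik), if k' = ik.2 then c 1 else c 0),
        (.inl (muxValue ik.1), d k'))
    | .inr (.inr (.inl (ik, k'))) => ((.inr (.inl ik), c 0),
        if k' = ik.2 then (.inl (muxSelect ik.1), c 0) else (.inr (.inr true), d k'))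
    | .inr (.inr (.inr (ik, false))) => ((.inr (.inl ik), c 1), (.inl (muxSelect ik.1), c 0))
    | .inr (.inr (.inr (ik, true))) => ((.inr (.inl ik), c 2), (.inl (muxSelect ik.1), c 1))
  refine ⟨_, inferInstance, fun x => match x with
    | .inl j => {k | (k : ℕ) < if (j : ℕ) < m then m else 2}
    | .inr (.inl _) => {k | (k : ℕ) < 3}
    | .inr (.inr _) => {k | (k : ℕ) < m},
    fun e => (f e).1.1, fun e => (f e).2.1, fun e => (f e).1.2, fun e => (f e).2.2, by simp,
    fun τ => ?_⟩
  have key := mux_constraints_iff (fun i => (τ (.inl (muxValue i)) : ℕ))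
    (fun i => (τ (.inl (muxSelect i)) : ℕ)) (fun i k => (τ (.inr (.inl (i, k))) : ℕ))
    (τ (.inr (.inr true))) (τ (.inr (.inr false)))
  refine Iff.trans ?_ key
  have hval : ∀ i : Fin m, (muxValue i : ℕ) < m := fun i => i.2
  have hsel : ∀ i : Fin m, ¬(muxSelect i : ℕ) < m := fun i => by simp [muxSelect]
  have hs : ∀ (i k k' : Fin m), (τ (if k' = k then (.inl (muxSelect i), c 0) else
      (.inr (.inr true), d k') : MuxVar m × Fin n).1 = (if k' = k then (.inl (muxSelect i), c 0) else
      (.inr (.inr true), d k') : MuxVar m × Fin n).2) ↔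
      if k' = k then (τ (.inl (muxSelect i)) : ℕ) = 0 else (τ (.inr (.inr true)) : ℕ) = k' := by
    intro i k k'
    split_ifs <;> simp [Fin.ext_iff, c, d]
  have hi : ∀ (P : Prop) [Decidable P] (k l : Fin n), ((if P then k else l : Fin n) : ℕ) =
      if P then (k : ℕ) else l := fun P _ k l => by split_ifs <;> rfl
  simp only [Sum.forall, forall_muxInput, Prod.forall, Bool.forall_bool, f, hs]
  simp only [Set.mem_ofPred_eq, hval, hsel, if_true, if_false, Fin.ext_iff (n := n), hi]
  simp only [c, d, Fin.val_castLE, Fin.val_zero, Fin.val_one, Fin.val_two, forall_and]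
  tauto

end Mux

theorem card_constraints_le {m n : ℕ} (hn : 3 ≤ n) (hmn : m ≤ n) :
    m * m + (m * m * m + (m * m * m + m * m * 2)) ≤ 3 * n ^ 3 := by
  calc m * m + (m * m * m + (m * m * m + m * m * 2))
      ≤ n * n + (n * n * n + (n * n * n + n * n * 2)) := by gcongr
    _ = 2 * n ^ 3 + 3 * n ^ 2 := by ring
    _ ≤ 2 * n ^ 3 + n * n ^ 2 := by gcongr
    _ = 3 * n ^ 3 := by ring

theorem card_vertices_le {m n : ℕ} (hn : 3 ≤ n) (hmn : m ≤ n) :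
    n + (2 * m + (m * m + 2) + (m * m + (m * m * m + (m * m * m + m * m * 2))) * (n + (n + 2))) ≤
      15 * n ^ 4 := by
  have h1 : 1 ≤ n ^ 4 := Nat.one_le_pow _ _ (by omega)
  have h2 : n ≤ n ^ 4 := Nat.le_self_pow (by norm_num) n
  have h3 : m * m ≤ n ^ 4 := (Nat.mul_le_mul hmn hmn).trans <| by
    rw [← pow_two]; exact Nat.pow_le_pow_right (by omega) (by norm_num)
  have h4 : (m * m + (m * m * m + (m * m * m + m * m * 2))) * (n + (n + 2)) ≤ 9 * n ^ 4 :=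
    calc _ ≤ 3 * n ^ 3 * (3 * n) := Nat.mul_le_mul (card_constraints_le hn hmn) (by omega)
      _ = 9 * n ^ 4 := by ring
  omega

theorem card_edges_le {m n : ℕ} (hn : 3 ≤ n) (hmn : m ≤ n) :
    n * (n + (2 * m + (m * m + 2) +
        (m * m + (m * m * m + (m * m * m + m * m * 2))) * (n + (n + 2)))) +
      ((m * m + (m * m * m + (m * m * m + m * m * 2))) * (n + (n + 2)) * 2 +
        (m * m + (m * m * m + (m * m * m + m * m * 2))) * (n + (n + 2)) * (n + (n + 2))) ≤
      100 * n ^ 5 := by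
  have h2 : n + (n + 2) ≤ 3 * n := by omega
  have h3 : 2 ≤ n := by omega
  calc _ ≤ n * (15 * n ^ 4) + (3 * n ^ 3 * (3 * n) * n + 3 * n ^ 3 * (3 * n) * (3 * n)) := by
        gcongr
        · exact card_vertices_le hn hmn
        · exact card_constraints_le hn hmn
        · exact card_constraints_le hn hmn
    _ = 51 * n ^ 5 := by ring
    _ ≤ 100 * n ^ 5 := by gcongr; norm_num

/-- There is a constant `c > 0` such that for all `m ≥ 2` and `n ≥ max(m,3)`, the
multiplexor `Mux_m : S^{2m} ⇀ S` — defined exactly on pairs `(v,u)` where the second block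
`u` is a 0-1 vector with a single 1 in some position `i`, with value `v i` — can be
simulated through `n`-colorings by a graph with at most `c·n⁴` vertices, `c·n⁵` edges. -/
theorem statement9 :
    ∃ c : ℕ, 0 < c ∧
      ∀ m n : ℕ, (hm : 2 ≤ m) → max m 3 ≤ n →
        ∃ (V : Type) (_ : Fintype V) (G : SimpleGraph V)
          (x : Fin (2 * m) → V) (y : Fin 1 → V) (r : Fin n → V),
          Simulates G m n
            (fun a : Fin (2 * m) → Fin m =>
              if h : ∃ i : Fin m, ∀ j : Fin m,
                  (a (⟨m + (j : ℕ), by have := j.isLt; omega⟩ : Fin (2 * m)) : ℕ) =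
                    if j = i then 1 else 0 then
                some fun _ : Fin 1 => a (Fin.castLE (by omega) h.choose)
              else none)
            x y r ∧
          Nat.card V ≤ c * n ^ 4 ∧ Nat.card G.edgeSet ≤ c * n ^ 5 := by
  refine ⟨100, by norm_num, fun m n hm hmn => ?_⟩
  have hn : 3 ≤ n := le_trans (le_max_right _ _) hmn
  replace hmn : m ≤ n := le_trans (le_max_left _ _) hmn
  obtain ⟨E, _, L, p, q, a₀, b₀, hE, hsat⟩ := exists_mux_constraints (m := m) hn hmn
  obtain ⟨V, _, G, ι, r, hr, hrefs, hsol, huniq, hV, hG⟩ :=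
    exists_graph_of_constraints hn L p q a₀ b₀
  simp only [hsat] at hsol
  refine ⟨V, inferInstance, G, fun j => ι (.inl j), fun _ => ι (.inr (.inr true)), r,
    ⟨hr, ?_, hrefs, fun a => ⟨⟨?_, ?_⟩, ?_, ?_⟩⟩, ?_, ?_⟩
  · let i : Fin m := ⟨0, by omega⟩
    obtain ⟨τ, hτ, -⟩ := exists_isMuxAssignment hn hmn
      (fun j => ⟨if j = muxSelect i then 1 else 0, by split_ifs <;> omega⟩) i
      (by simp [muxSelect, Fin.ext_iff])
      (fun j => by dsimp only; split_ifs <;> omega)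
    obtain ⟨σ, hσ, -⟩ := (hsol τ).2 ⟨i, hτ⟩
    exact ⟨σ, hσ⟩
  · rintro ⟨σ, hσ, hσr, hσx⟩
    obtain ⟨i, -, hu, hv, -⟩ := (hsol fun z => σ (ι z)).1 ⟨σ, hσ, hσr, fun _ => rfl⟩
    simp only [hσx] at hu hv
    have hlt : ∀ j, (a j : ℕ) < m :=
      forall_muxInput.2 ⟨hv, fun j => by rw [hu]; split_ifs <;> omega⟩
    refine ⟨fun j => ⟨a j, hlt j⟩, fun j => rfl, ?_⟩
    exact (congrArg Option.isSome (dif_pos ⟨i, hu⟩)).trans rfl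
  · rintro ⟨a', haa, hφ⟩
    dsimp only at hφ
    split_ifs at hφ with h
    · obtain ⟨i, hi⟩ := h
      obtain ⟨τ, hτ, hτa⟩ := exists_isMuxAssignment hn hmn a i
        (fun j => (haa _).trans (hi j)) (fun j => by rw [haa]; exact (a' _).2)
      obtain ⟨σ, hσ, hσr, hστ⟩ := (hsol τ).2 ⟨i, hτ⟩
      exact ⟨σ, hσ, hσr, fun j => (hστ _).trans (hτa j)⟩
    · simp at hφ
  · intro σ τ hσ hτ hσr hτr hσx hτx
    refine huniq σ τ hσ hτ hσr hτr fun z => ?_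
    obtain ⟨i, hi⟩ := (hsol fun z => σ (ι z)).1 ⟨σ, hσ, hσr, fun _ => rfl⟩
    obtain ⟨j, hj⟩ := (hsol fun z => τ (ι z)).1 ⟨τ, hτ, hτr, fun _ => rfl⟩
    exact congrFun (hi.eq hj fun k => (hσx k).trans (hτx k).symm) z
  · intro σ hσ hσr hσx a' b haa hφ k
    obtain ⟨i, -, hu, -, hy, -⟩ := (hsol fun z => σ (ι z)).1 ⟨σ, hσ, hσr, fun _ => rfl⟩
    simp only [hσx] at hu hy
    dsimp only at hφ ⊢
    split_ifs at hφ with h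
    obtain rfl := Option.some.inj hφ
    have hi : h.choose = i := by
      have e1 : (a' (muxSelect i) : ℕ) = if i = h.choose then 1 else 0 := h.choose_spec i
      have e2 := (haa (muxSelect i)).symm.trans (hu i)
      rw [e1] at e2
      by_contra hne
      simp [Ne.symm hne] at e2
    rw [hy, hi]
    exact haa _
  · have := card_vertices_le hn hmn
    rw [hV, hE]
    simp only [MuxVar, Fintype.card_sum, Fintype.card_prod, Fintype.card_fin, Fintype.card_bool]
    omega
  · rw [hE] at hG
    simp only [MuxVar, Fintype.card_sum, Fintype.card_prod, Fintype.card_fin,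
      Fintype.card_bool] at hG
    exact hG.trans (card_edges_le hn hmn)
end

section
/- There is a constant c > 0 such that for all integers m ≥ 2 and n ≥ max(m,3), the partial function xt_m : S^m ⇀ S — defined by xt_m(u) = 0 if u is the all-zero vector, xt_m(u) = k if u has at least one nonzero entry and every nonzero entry of u equals k, and xt_m(u) undefined otherwise (i.e., when u has two distinct nonzero entry values) — can be simulated through n-colorings by a finite simple graph with at most c·n⁴ vertices and at most c·n⁵ edges. -/
/-- The complete graph on the `n` reference vertices `Sum.inl c`, together with further vertices
`Sum.inr u` that are joined by `E` and confined to the list of colors `c` with `L u c`. -/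
def listGraph {n : ℕ} {U : Type} (L : U → Fin n → Prop) (E : U → U → Prop) :
    SimpleGraph (Fin n ⊕ U) :=
  SimpleGraph.fromRel fun p q =>
    match p, q with
    | .inl i, .inl j => i ≠ j
    | .inl c, .inr u => ¬ L u c
    | .inr u, .inr v => E u v
    | .inr _, .inl _ => False

/-- A list coloring: every color lies in its list, and related vertices get different colors. -/
def IsListColoring {n : ℕ} {U : Type} (L : U → Fin n → Prop) (E : U → U → Prop)
    (σ : U → Fin n) : Prop :=
  (∀ u, L u (σ u)) ∧ ∀ u v, E u v → σ u ≠ σ v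

lemma injective_of_isProperColoring_listGraph {n : ℕ} {U : Type} {L : U → Fin n → Prop}
    {E : U → U → Prop} {σ : Fin n ⊕ U → Fin n} (h : IsProperColoring (listGraph L E) σ) :
    Function.Injective fun i => σ (.inl i) := by
  intro i j hij
  by_contra hne
  exact h (u := .inl i) (v := .inl j) (by simp [listGraph, hne]) hij

lemma isProperColoring_listGraph_iff {n : ℕ} {U : Type} {L : U → Fin n → Prop}
    {E : U → U → Prop} (hE : ∀ u, ¬ E u u) {σ : Fin n ⊕ U → Fin n}
    (hσ : ∀ i, σ (.inl i) = i) :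
    IsProperColoring (listGraph L E) σ ↔ IsListColoring L E fun u => σ (.inr u) := by
  constructor
  · intro h
    refine ⟨fun u => ?_, fun u v huv => ?_⟩
    · by_contra hL
      exact h (u := .inl (σ (.inr u))) (v := .inr u) (by simp [listGraph, hL]) (hσ _)
    · have hne : u ≠ v := fun e => hE u (e ▸ huv)
      exact h (u := .inr u) (v := .inr v) (by simp [listGraph, hne, huv])
  · rintro ⟨hL, hC⟩ (i | u) (j | v) hadj <;> simp only [listGraph, SimpleGraph.fromRel_adj] at hadj
    · rw [hσ, hσ]
      exact fun e => hadj.1 (congrArg _ e)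
    · intro e
      rw [hσ] at e
      subst e
      simp [hL v] at hadj
    · intro e
      rw [hσ] at e
      subst e
      simp [hL u] at hadj
    · rcases hadj.2 with h | h
      · exact hC u v h
      · exact (hC v u h).symm

lemma exists_le_iff_of_lt {m n : ℕ} {a : Fin m → Fin n} (i : Fin m) (j : Fin n) :
    (∃ i' ≤ i, a i' = j) ↔ (∃ i' < i, a i' = j) ∨ a i = j := by
  constructor
  · rintro ⟨i', h, e⟩
    rcases h.lt_or_eq with h | rfl
    · exact .inl ⟨i', h, e⟩
    · exact .inr e
  · rintro (⟨i', h, e⟩ | e)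
    · exact ⟨i', h.le, e⟩
    · exact ⟨i, le_rfl, e⟩

lemma exists_lt_iff_of_succ {m n : ℕ} {a : Fin m → Fin n} {i i' : Fin m} (h : (i : ℕ) + 1 = i')
    (j : Fin n) : (∃ l < i', a l = j) ↔ ∃ l ≤ i, a l = j := by
  refine exists_congr fun l => and_congr_left' ?_
  rw [Fin.lt_def, Fin.le_def]
  omega

lemma exists_le_last_iff {m n : ℕ} {a : Fin m → Fin n} {i : Fin m} (h : (i : ℕ) + 1 = m)
    (j : Fin n) : (∃ l ≤ i, a l = j) ↔ ∃ l, a l = j := by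
  refine exists_congr fun l => and_iff_right ?_
  rw [Fin.le_def]
  omega

/-- A nonzero symbol, seen as a color. -/
abbrev NzSym (m n : ℕ) [NeZero n] : Type := {j : Fin n // j ≠ 0 ∧ (j : ℕ) < m}

/-- Vertices of the gadget. `ind i j` is `0` if input `i` is `j`, and `j` otherwise; `acc i j` is
`0` if one of the inputs up to `i` is `j`, and `j` otherwise. The remaining vertices with index
`(i, j)` form an OR gate computing `acc i j` from `ind i j` and the preceding `acc`. -/
inductive Node (m n : ℕ) [NeZero n] : Type
  | input (i : Fin m)
  | output
  | ind (i : Fin m) (j : NzSym m n)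
  | conv (i : Fin m) (j : NzSym m n)
  | aux (i : Fin m) (j : NzSym m n)
  | coaux (i : Fin m) (j : NzSym m n)
  | sel (i : Fin m) (j : NzSym m n)
  | acc (i : Fin m) (j : NzSym m n)
  | rest (i : Fin m) (j : NzSym m n)

section

variable {m n : ℕ} [NeZero n]

/-- The color lists of the gadget; `e j` is a color different from `0` and `j`. -/
def Node.Allowed (e : Fin n → Fin n) : Node m n → Fin n → Prop
  | .input _, c => (c : ℕ) < m
  | .output, c => (c : ℕ) < m
  | .ind _ j, c => c = 0 ∨ c = j
  | .conv _ j, c => c = j ∨ c = e j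
  | .aux _ j, c => c = 0 ∨ c = e j
  | .coaux _ j, c => c = 0 ∨ c = e j
  | .sel i j, c => (c = 0 ∨ c = j ∨ c = e j) ∧ ((i : ℕ) = 0 → c ≠ j)
  | .acc _ j, c => c = 0 ∨ c = j
  | .rest _ j, c => c = j ∨ c = e j

/-- The edges of the gadget. -/
inductive Node.Edge : Node m n → Node m n → Prop
  | input_ind (i j) : Edge (.input i) (.ind i j)
  | ind_ind (i) {j j'} (h : j ≠ j') : Edge (.ind i j) (.ind i j')
  | ind_conv (i j) : Edge (.ind i j) (.conv i j)
  | ind_aux (i j) : Edge (.ind i j) (.aux i j)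
  | conv_aux (i j) : Edge (.conv i j) (.aux i j)
  | aux_coaux (i j) : Edge (.aux i j) (.coaux i j)
  | conv_sel (i j) : Edge (.conv i j) (.sel i j)
  | coaux_sel (i j) : Edge (.coaux i j) (.sel i j)
  | acc_sel {i i' : Fin m} (j) (h : (i : ℕ) + 1 = i') : Edge (.acc i j) (.sel i' j)
  | sel_acc (i j) : Edge (.sel i j) (.acc i j)
  | sel_rest (i j) : Edge (.sel i j) (.rest i j)
  | acc_rest (i j) : Edge (.acc i j) (.rest i j)
  | output_acc {i : Fin m} (j) (h : (i : ℕ) + 1 = m) : Edge .output (.acc i j)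
  | acc_acc {i : Fin m} {j j'} (h : (i : ℕ) + 1 = m) (hj : j ≠ j') : Edge (.acc i j) (.acc i j')

lemma Node.Edge.irrefl (u : Node m n) : ¬ u.Edge u := by
  intro h
  cases h <;> contradiction

open Classical in
/-- The coloring of the gadget forced by the input colors `a` and the output color `k`. -/
noncomputable def Node.color (e : Fin n → Fin n) (a : Fin m → Fin n) (k : Fin n) :
    Node m n → Fin n
  | .input i => a i
  | .output => k
  | .ind i j => if a i = j then 0 else j
  | .conv i j => if a i = j then j else e j
  | .aux i j => if a i = j then e j else 0
  | .coaux i j => if a i = j then 0 else e j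
  | .sel i j => if a i = j then e j else if ∃ i' < i, a i' = j then j else 0
  | .acc i j => if ∃ i' ≤ i, a i' = j then 0 else j
  | .rest i j => if a i = j then j else e j

/-- The color `k` is the common value of the nonzero entries of `a`, or `0` if there are none. -/
def IsCommonSymbol (a : Fin m → Fin n) (k : Fin n) : Prop :=
  (k : ℕ) < m ∧ (∀ i, (a i : ℕ) < m) ∧ ∀ j ≠ 0, k = j ↔ ∃ i, a i = j

open Classical in
/-- In a clique, a vertex `y` with list `S` and vertices `w j` with lists `{0, j}` have a unique
coloring for each color of `y`. -/
lemma star_forced {y : Fin n} (hy : (y : ℕ) < m) {w : NzSym m n → Fin n}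
    (hw : ∀ j, w j = 0 ∨ w j = j) (hyw : ∀ j, y ≠ w j) (hww : ∀ j j', j ≠ j' → w j ≠ w j')
    (j : NzSym m n) : w j = if y = j then 0 else (j : Fin n) := by
  split_ifs with h
  · exact (hw j).resolve_right fun h' => hyw j (h.trans h'.symm)
  · refine (hw j).resolve_left fun h0 => ?_
    have hy0 : y ≠ 0 := fun h' => hyw j (h'.trans h0.symm)
    let j' : NzSym m n := ⟨y, hy0, hy⟩
    have h0' : w j' = 0 := (hw j').resolve_right fun h' => hyw j' h'.symm
    exact hww j j' (fun h' => h (congrArg Subtype.val h').symm) (h0.trans h0'.symm)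

open Classical in
lemma star_proper {y : Fin n} {j j' : NzSym m n} (h : j ≠ j') :
    (if y = j then 0 else (j : Fin n)) ≠ if y = j' then 0 else (j' : Fin n) := by
  have := j.2.1
  have := j'.2.1
  have : (j : Fin n) ≠ j' := fun h' => h (Subtype.ext h')
  split_ifs <;> grind

lemma isListColoring_color {e : Fin n → Fin n} (he : ∀ j ≠ 0, e j ≠ 0 ∧ e j ≠ j)
    {a : Fin m → Fin n} {k : Fin n} (h : IsCommonSymbol a k) :
    IsListColoring (Node.Allowed e) Node.Edge (Node.color (m := m) e a k) := by
  obtain ⟨hk, ha, hak⟩ := h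
  have star (y : Fin n) (j : NzSym m n) : y ≠ if y = j then 0 else (j : Fin n) := by
    have := j.2.1
    split_ifs <;> grind
  have last {i : Fin m} (hi : (i : ℕ) + 1 = m) (j : NzSym m n) :
      Node.color e a k (.acc i j) = if k = j then 0 else (j : Fin n) := by
    simp only [Node.color, exists_le_last_iff hi, hak j j.2.1]
  refine ⟨?_, ?_⟩
  · rintro (i | _ | ⟨i, j⟩ | ⟨i, j⟩ | ⟨i, j⟩ | ⟨i, j⟩ | ⟨i, j⟩ | ⟨i, j⟩ | ⟨i, j⟩)
    case sel =>
      have h1 := j.2.1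
      have h2 := he j j.2.1
      have h3 : (i : ℕ) = 0 → ¬ ∃ i' < i, a i' = j := by
        rintro h0 ⟨i', h', -⟩
        rw [Fin.lt_def] at h'
        omega
      simp only [Node.color, Node.Allowed]
      split_ifs <;> grind
    all_goals simp only [Node.color, Node.Allowed, ha, hk] <;> split_ifs <;> simp
  · intro u v huv
    cases huv with
    | input_ind i j => simpa [Node.color] using star (a i) j
    | ind_ind i hj => simpa [Node.color] using star_proper hj
    | output_acc j hi =>
      rw [last hi]
      exact star k j
    | acc_acc hi hj =>
      rw [last hi, last hi]
      exact star_proper hj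
    | acc_sel j hi =>
      have h1 := j.2.1
      have h2 := he j j.2.1
      simp only [Node.color, exists_lt_iff_of_succ hi]
      split_ifs <;> grind
    | _ i j =>
      have h1 := j.2.1
      have h2 := he j j.2.1
      simp only [Node.color, exists_le_iff_of_lt]
      split_ifs <;> grind

lemma IsListColoring.eq_color {e : Fin n → Fin n} (he : ∀ j ≠ 0, e j ≠ 0 ∧ e j ≠ j)
    (hm : 0 < m) {σ : Node m n → Fin n} (h : IsListColoring (Node.Allowed e) Node.Edge σ) :
    IsCommonSymbol (fun i => σ (.input i)) (σ .output) ∧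
      σ = Node.color e (fun i => σ (.input i)) (σ .output) := by
  classical
  obtain ⟨hL, hE⟩ := h
  set a : Fin m → Fin n := fun i => σ (.input i) with ha
  set s := Node.color e a (σ .output) with hs
  have hind (i j) : σ (.ind i j) = s (.ind i j) :=
    star_forced (w := fun j => σ (.ind i j)) (hL (.input i)) (fun j => hL (.ind i j))
      (fun j => hE _ _ (.input_ind i j)) (fun j j' hj => hE _ _ (.ind_ind i hj)) j
  have hgate (i j) : σ (.conv i j) = s (.conv i j) ∧ σ (.aux i j) = s (.aux i j) ∧
      σ (.coaux i j) = s (.coaux i j) := by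
    have h1 := j.2.1
    have h2 := he j j.2.1
    have h3 := hind i j
    have h4 := hL (.conv i j)
    have h5 := hL (.aux i j)
    have h6 := hL (.coaux i j)
    have h7 := hE _ _ (.ind_conv i j)
    have h8 := hE _ _ (.ind_aux i j)
    have h9 := hE _ _ (.conv_aux i j)
    have h10 := hE _ _ (.aux_coaux i j)
    simp only [hs, Node.color, Node.Allowed] at *
    by_cases hij : a i = j <;> simp only [hij, if_true, if_false] at * <;> grind
  have hor (i j) (hprev : σ (.sel i j) ≠ if ∃ i' < i, a i' = j then 0 else (j : Fin n)) :
      σ (.sel i j) = s (.sel i j) ∧ σ (.acc i j) = s (.acc i j) ∧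
        σ (.rest i j) = s (.rest i j) := by
    have h1 := j.2.1
    have h2 := he j j.2.1
    obtain ⟨h3, -, h3'⟩ := hgate i j
    have h4 := hL (.sel i j)
    have h5 := hL (.acc i j)
    have h6 := hL (.rest i j)
    have h7 := hE _ _ (.conv_sel i j)
    have h8 := hE _ _ (.coaux_sel i j)
    have h9 := hE _ _ (.sel_acc i j)
    have h10 := hE _ _ (.sel_rest i j)
    have h11 := hE _ _ (.acc_rest i j)
    simp only [hs, Node.color, Node.Allowed, exists_le_iff_of_lt] at *
    by_cases hij : a i = j <;> by_cases hP : ∃ i' < i, a i' = j <;>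
      simp only [hij, hP, if_true, if_false, or_true, or_false] at * <;> grind
  have hprev (N : ℕ) : ∀ i : Fin m, (i : ℕ) = N → ∀ j : NzSym m n,
      σ (.sel i j) ≠ if ∃ i' < i, a i' = j then 0 else (j : Fin n) := by
    induction N with
    | zero =>
      intro i hi j
      rw [if_neg]
      · exact (hL (.sel i j)).2 hi
      · rintro ⟨i', h', -⟩
        rw [Fin.lt_def] at h'
        omega
    | succ N ih =>
      intro i hi j
      let i' : Fin m := ⟨N, by omega⟩
      have hi' : (i' : ℕ) + 1 = i := hi.symm
      have h1 := (hor i' j (ih i' rfl j)).2.1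
      have h2 := hE _ _ (.acc_sel j hi')
      rw [h1] at h2
      simp only [exists_lt_iff_of_succ hi']
      exact h2.symm
  have hor' (i j) := hor i j (hprev i i rfl j)
  refine ⟨⟨hL .output, fun i => hL (.input i), fun j hj => ?_⟩, ?_⟩
  · by_cases hjm : (j : ℕ) < m
    · let j' : NzSym m n := ⟨j, hj, hjm⟩
      let i : Fin m := ⟨m - 1, by omega⟩
      have hi : (i : ℕ) + 1 = m := Nat.succ_pred_eq_of_pos hm
      have h1 := star_forced (w := fun j => σ (.acc i j)) (hL .output) (fun j => hL (.acc i j))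
        (fun j => hE _ _ (.output_acc j hi)) (fun j j' hj => hE _ _ (.acc_acc hi hj)) j'
      have h2 := (hor' i j').2.1
      rw [h1] at h2
      simp only [hs, Node.color, exists_le_last_iff hi, j'] at h2
      split_ifs at h2 <;> grind
    · constructor
      · rintro rfl
        exact absurd (hL .output) hjm
      · rintro ⟨i, rfl⟩
        exact absurd (hL (.input i)) hjm
  · funext u
    cases u with
    | input i => rfl
    | output => rfl
    | ind i j => exact hind i j
    | conv i j => exact (hgate i j).1
    | aux i j => exact (hgate i j).2.1
    | coaux i j => exact (hgate i j).2.2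
    | sel i j => exact (hor' i j).1
    | acc i j => exact (hor' i j).2.1
    | rest i j => exact (hor' i j).2.2

lemma IsCommonSymbol.unique {a : Fin m → Fin n} {k l : Fin n} (hk : IsCommonSymbol a k)
    (hl : IsCommonSymbol a l) : k = l := by
  by_cases h : k = 0
  · by_contra hne
    have hl0 : l ≠ 0 := fun h' => hne (h.trans h'.symm)
    exact hne ((hk.2.2 l hl0).2 ((hl.2.2 l hl0).1 rfl))
  · exact ((hl.2.2 k h).2 ((hk.2.2 k h).1 rfl)).symm

lemma isCommonSymbol_iff {a : Fin m → Fin n} {a' : Fin m → Fin m} {k : Fin n} {k' : Fin m}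
    (ha : ∀ i, (a i : ℕ) = a' i) (hk : (k : ℕ) = k') :
    IsCommonSymbol a k ↔
      (∀ i, (a' i : ℕ) = 0 ∨ a' i = k') ∧ ((∀ i, (a' i : ℕ) = 0) → (k' : ℕ) = 0) := by
  simp only [IsCommonSymbol, Fin.ext_iff, ne_eq, ha, hk, Fin.is_lt, true_and, implies_true,
    Fin.val_zero]
  constructor
  · intro h
    refine ⟨fun i => ?_, fun h0 => ?_⟩
    · by_contra! hi
      exact hi.2 (((h (a i) (by rw [ha]; exact hi.1)).2 ⟨i, (ha i).symm⟩).trans (ha i)).symm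
    · by_contra hk0
      obtain ⟨i, hi⟩ := (h k (by rwa [hk])).1 hk.symm
      exact hk0 (by rw [← hk, ← hi, h0])
  · rintro ⟨h1, h2⟩ j hj
    constructor
    · intro hkj
      by_contra! hne
      refine hj (hkj ▸ h2 fun i => (h1 i).resolve_right fun h => hne i (h.trans hkj))
    · rintro ⟨i, hi⟩
      exact ((h1 i).resolve_left (hi ▸ hj)).symm.trans hi

/-- An injection bounding the number of vertices. -/
def Node.code : Fin n ⊕ Node m n → Fin 10 × Fin n × Fin (n + m)
  | .inl c => (0, c, c.castAdd m)
  | .inr (.input i) => (1, 0, i.natAdd n)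
  | .inr .output => (2, 0, (0 : Fin n).castAdd m)
  | .inr (.ind i j) => (3, j, i.natAdd n)
  | .inr (.conv i j) => (4, j, i.natAdd n)
  | .inr (.aux i j) => (5, j, i.natAdd n)
  | .inr (.coaux i j) => (6, j, i.natAdd n)
  | .inr (.sel i j) => (7, j, i.natAdd n)
  | .inr (.acc i j) => (8, j, i.natAdd n)
  | .inr (.rest i j) => (9, j, i.natAdd n)

lemma Node.code_injective : Function.Injective (Node.code (m := m) (n := n)) := by
  rintro (c | u) (d | v) h
  · simpa [Node.code] using h
  · cases v <;> simp [Node.code] at h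
  · cases u <;> simp [Node.code] at h
  · cases u <;> cases v <;> simp_all [Node.code] <;> exact Subtype.ext h.1

lemma Node.card_le : Nat.card (Fin n ⊕ Node m n) ≤ 10 * (n * (n + m)) := by
  simpa using Nat.card_le_card_of_injective _ (Node.code_injective (m := m) (n := n))

end

lemma card_edgeSet_le {V : Type} [Finite V] (G : SimpleGraph V) :
    Nat.card G.edgeSet ≤ Nat.card V ^ 2 := by
  have h : Function.Surjective fun p : V × V => s(p.1, p.2) := by
    rintro ⟨u, v⟩
    exact ⟨(u, v), rfl⟩
  calc Nat.card G.edgeSet ≤ Nat.card (Sym2 V) :=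
        Nat.card_le_card_of_injective _ Subtype.val_injective
    _ ≤ Nat.card (V × V) := Nat.card_le_card_of_surjective _ h
    _ = Nat.card V ^ 2 := by rw [Nat.card_prod, sq]

lemma exists_third_color {n : ℕ} [NeZero n] (hn : 3 ≤ n) :
    ∃ e : Fin n → Fin n, ∀ j ≠ 0, e j ≠ 0 ∧ e j ≠ j := by
  refine ⟨fun j => if (j : ℕ) = 1 then ⟨2, by omega⟩ else ⟨1, by omega⟩, fun j _ => ?_⟩
  dsimp only
  split_ifs with h <;> simp [Fin.ext_iff] <;> omega

/-- There is a constant `c > 0` such that for all `m ≥ 2` and `n ≥ max(m,3)`, the partial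
function `xt_m : S^m ⇀ S` — `xt_m(u) = 0` if `u` is the all-zero vector, `xt_m(u) = k` if
`u` has a nonzero entry and every nonzero entry equals `k`, and undefined otherwise — can
be simulated through `n`-colorings by a graph with at most `c·n⁴` vertices, `c·n⁵` edges.
(The witness `k` in the definition below is unique, so `h.choose` is the stated value.) -/
theorem statement11 :
    ∃ c : ℕ, 0 < c ∧
      ∀ m n : ℕ, (hm : 2 ≤ m) → max m 3 ≤ n →
        ∃ (V : Type) (_ : Fintype V) (G : SimpleGraph V)
          (x : Fin m → V) (y : Fin 1 → V) (r : Fin n → V),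
          Simulates G m n
            (fun u : Fin m → Fin m =>
              if h : ∃ k : Fin m,
                  (∀ i : Fin m, (u i : ℕ) = 0 ∨ u i = k) ∧
                  ((∀ i : Fin m, (u i : ℕ) = 0) → (k : ℕ) = 0) then
                some fun _ : Fin 1 => h.choose
              else none)
            x y r ∧
          Nat.card V ≤ c * n ^ 4 ∧ Nat.card G.edgeSet ≤ c * n ^ 5 := by
  refine ⟨400, by norm_num, fun m n hm hmn => ?_⟩
  have hn : 3 ≤ n := le_of_max_le_right hmn
  have hle : m ≤ n := le_of_max_le_left hmn
  have : NeZero n := ⟨by omega⟩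
  obtain ⟨e, he⟩ := exists_third_color hn
  have hfin : Finite (Fin n ⊕ Node m n) := Finite.of_injective _ Node.code_injective
  let L : Node m n → Fin n → Prop := Node.Allowed e
  let ext (σ : Node m n → Fin n) : Fin n ⊕ Node m n → Fin n := Sum.elim id σ
  have hext {a : Fin m → Fin n} {k : Fin n} (h : IsCommonSymbol a k) :
      IsProperColoring (listGraph L Node.Edge) (ext (Node.color e a k)) :=
    (isProperColoring_listGraph_iff Node.Edge.irrefl fun _ => rfl).2 (isListColoring_color he h)
  have hforced {σ : Fin n ⊕ Node m n → Fin n} {a : Fin m → Fin n}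
      (h : IsProperColoring (listGraph L Node.Edge) σ) (hr : ∀ i, σ (.inl i) = i)
      (ha : ∀ i, σ (.inr (.input i)) = a i) :
      IsCommonSymbol a (σ (.inr .output)) ∧
        σ = ext (Node.color e a (σ (.inr .output))) := by
    obtain rfl : (fun i => σ (.inr (.input i))) = a := funext ha
    obtain ⟨h1, h2⟩ := ((isProperColoring_listGraph_iff Node.Edge.irrefl hr).1 h).eq_color he
      (by omega)
    refine ⟨h1, funext ?_⟩
    rintro (i | u)
    · exact hr i
    · exact congrFun h2 u
  have hcard : Nat.card (Fin n ⊕ Node m n) ≤ 20 * n ^ 2 :=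
    Node.card_le.trans (by nlinarith)
  refine ⟨Fin n ⊕ Node m n, Fintype.ofFinite _, listGraph L Node.Edge,
    fun i => .inr (.input i), fun _ => .inr .output, .inl,
    ⟨Sum.inl_injective, ?_, fun σ hσ => injective_of_isProperColoring_listGraph hσ,
      fun a => ⟨⟨?_, ?_⟩, ?_, ?_⟩⟩, ?_, ?_⟩
  · refine ⟨_, hext (a := fun _ => 0) (k := 0) ⟨?_, fun _ => ?_, fun j hj => ?_⟩⟩
    · simp; omega
    · simp; omega
    · simp [hj.symm]
  · rintro ⟨σ, hσ, hr, ha⟩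
    have hk := (hforced hσ hr ha).1
    refine ⟨fun i => ⟨a i, hk.2.1 i⟩, fun _ => rfl, ?_⟩
    have hk' := (isCommonSymbol_iff (a := a) (a' := fun i => ⟨a i, hk.2.1 i⟩) (k' := ⟨_, hk.1⟩)
      (fun _ => rfl) rfl).1 hk
    dsimp only
    rw [dif_pos ⟨_, hk'⟩]
    rfl
  · rintro ⟨a', ha', hsome⟩
    dsimp only at hsome
    split_ifs at hsome with h
    · obtain ⟨k, hk⟩ := h
      have hk' : IsCommonSymbol a (k.castLE hle) := (isCommonSymbol_iff ha' rfl).2 hk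
      exact ⟨_, hext hk', fun _ => rfl, fun _ => rfl⟩
    · simp at hsome
  · intro σ τ hσ hτ hσr hτr hσa hτa
    obtain ⟨h1, h2⟩ := hforced hσ hσr hσa
    obtain ⟨h3, h4⟩ := hforced hτ hτr hτa
    rw [h2, h4, h1.unique h3]
  · intro σ hσ hr ha a' b ha' hb _
    have hk := (hforced hσ hr ha).1
    dsimp only at hb
    split_ifs at hb with h
    obtain rfl := Option.some.inj hb
    have hk' : IsCommonSymbol a (h.choose.castLE hle) :=
      (isCommonSymbol_iff ha' rfl).2 h.choose_spec
    exact congrArg Fin.val (hk.unique hk')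
  · exact hcard.trans (Nat.mul_le_mul (by norm_num) (Nat.pow_le_pow_right (by omega) (by norm_num)))
  · calc Nat.card (listGraph L Node.Edge).edgeSet
        ≤ Nat.card (Fin n ⊕ Node m n) ^ 2 := card_edgeSet_le _
      _ ≤ (20 * n ^ 2) ^ 2 := Nat.pow_le_pow_left hcard 2
      _ = 400 * n ^ 4 := by ring
      _ ≤ 400 * n ^ 5 := Nat.mul_le_mul le_rfl (Nat.pow_le_pow_right (by omega) (by norm_num))
end

section
/- There is a constant c > 0 such that for all integers m ≥ 2 and n ≥ max(m,3), the total functions add_m : S² → S, add_m(x,y) = x + y (mod m), and sub_m : S² → S, sub_m(x,y) = x − y (mod m), can each be simulated through n-colorings by a finite simple graph with at most c·n⁴ vertices and at most c·n⁵ edges. -/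
/-- The vertices of the graph simulating a binary operation: reference vertices, the ports
(two inputs and one output), two-valued indicators of whether port `v` has color `i`, and
for each pair `(i, j)` a three-valued vertex comparing the inputs with `i` and `j` together with
two vertices detecting two of its values. -/
inductive OpVertex (n : ℕ) : Type
  | ref (i : Fin n)
  | port (v : Fin 3)
  | ind (v : Fin 3) (i : Fin n) (α β : Option (Fin 3))
  | cmp (i j : Fin n)
  | half (i j : Fin n)
  | both (i j : Fin n)

namespace OpVertex

variable {n : ℕ} {A : Type}

/-- The intended color of a vertex when the port `v` has color `p v a`; the colors `c 0`, `c 1`,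
`c 2` play the role of truth values. -/
def color (c : Fin 3 → Fin n) (p : Fin 3 → A → Fin n) (a : A) : OpVertex n → Fin n
  | ref i => i
  | port v => p v a
  | ind v i α β => if p v a = i then α.elim i c else β.elim i c
  | cmp i j => if p 0 a = i then if p 1 a = j then c 2 else c 1 else c 0
  | half i j => if p 0 a = i ∧ p 1 a ≠ j then c 0 else c 1
  | both i j => if p 0 a = i ∧ p 1 a = j then c 0 else c 2

/-- A vertex whose color alternates between `α` and `β`, according to whether port `v` has
color `i`. -/
def IsInd (c : Fin 3 → Fin n) (p : Fin 3 → A → Fin n) (u : OpVertex n) (v : Fin 3)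
    (i α β : Fin n) : Prop :=
  ∀ a, color c p a u = if p v a = i then α else β

lemma isInd_ind {c : Fin 3 → Fin n} {p : Fin 3 → A → Fin n} (v : Fin 3) (i : Fin n)
    (α β : Option (Fin 3)) :
    IsInd c p (ind v i α β) v i (α.elim i c) (β.elim i c) := fun _ => rfl

/-- Two vertices are adjacent when their intended colors always differ. -/
def graph [Nonempty A] (c : Fin 3 → Fin n) (p : Fin 3 → A → Fin n) :
    SimpleGraph (OpVertex n) where
  Adj u v := ∀ a, color c p a u ≠ color c p a v
  symm := ⟨fun _ _ h a => (h a).symm⟩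
  loopless := ⟨fun _ h => h (Classical.arbitrary A) rfl⟩

variable [Nonempty A] {c : Fin 3 → Fin n} {p : Fin 3 → A → Fin n} {τ : OpVertex n → Fin n}

lemma isProperColoring_color (a : A) : IsProperColoring (graph c p) (color c p a) :=
  fun _ _ h => h a

lemma exists_color_eq (hτ : IsProperColoring (graph c p) τ) (href : ∀ i, τ (ref i) = i)
    (u : OpVertex n) : ∃ a, color c p a u = τ u := by
  by_contra! h
  exact hτ (show (graph c p).Adj u (ref (τ u)) from h) (href _).symm

lemma IsInd.eq_or_eq (hτ : IsProperColoring (graph c p) τ) (href : ∀ i, τ (ref i) = i)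
    {u : OpVertex n} {v : Fin 3} {i α β : Fin n} (h : IsInd c p u v i α β) :
    τ u = α ∨ τ u = β := by
  obtain ⟨a, ha⟩ := exists_color_eq hτ href u
  grind [h a]

/-- Indicators whose second color is the tested one are forced by the clique they form
together with the port. -/
lemma IsInd.apply_eq_of_self (hτ : IsProperColoring (graph c p) τ) (href : ∀ i, τ (ref i) = i)
    {u : OpVertex n} {v : Fin 3} {i : Fin n} {b : Fin 3} (hb : c b ≠ i)
    (h : IsInd c p u v i (c b) i) : τ u = if τ (port v) = i then c b else i := by
  have key : ∀ {u i}, c b ≠ i → IsInd c p u v i (c b) i → τ u ≠ τ (port v) := by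
    intro u i hb h
    refine hτ fun a => ?_
    have := h a
    simp only [color] at this ⊢
    grind
  have h1 := key hb h
  have h2 := h.eq_or_eq hτ href
  by_cases hp : τ (port v) = i
  · grind
  by_cases hpb : τ (port v) = c b
  · grind
  have hw := isInd_ind (c := c) (p := p) v (τ (port v)) (some b) none
  have h3 := key (Ne.symm hpb) hw
  have h4 := hw.eq_or_eq hτ href
  have h5 : τ u ≠ τ (ind v (τ (port v)) (some b) none) := by
    refine hτ fun a => ?_
    have := h a
    have := hw a
    simp only [Option.elim] at this
    grind
  simp only [Option.elim] at h4
  grind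

/-- An indicator forces the two others with which it forms a triangle. -/
lemma IsInd.apply_eq_of_triangle (hτ : IsProperColoring (graph c p) τ)
    (href : ∀ i, τ (ref i) = i) {u₁ u₂ u₃ : OpVertex n} {v : Fin 3} {i α β γ : Fin n}
    (hαβ : α ≠ β) (hβγ : β ≠ γ) (hγα : γ ≠ α)
    (h₁ : IsInd c p u₁ v i β γ) (h₂ : IsInd c p u₂ v i γ α) (h₃ : IsInd c p u₃ v i α β)
    (hu : τ u₁ = if τ (port v) = i then β else γ) :
    (τ u₂ = if τ (port v) = i then γ else α) ∧ τ u₃ = if τ (port v) = i then α else β := by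
  have h12 : τ u₁ ≠ τ u₂ := hτ fun a => by grind [h₁ a, h₂ a]
  have h13 : τ u₁ ≠ τ u₃ := hτ fun a => by grind [h₁ a, h₃ a]
  have h23 : τ u₂ ≠ τ u₃ := hτ fun a => by grind [h₂ a, h₃ a]
  have := h₂.eq_or_eq hτ href
  have := h₃.eq_or_eq hτ href
  grind

lemma apply_ind (hc : Function.Injective c) (hτ : IsProperColoring (graph c p) τ)
    (href : ∀ i, τ (ref i) = i) (v : Fin 3) (i : Fin n) (α β : Option (Fin 3)) :
    τ (ind v i α β) = if τ (port v) = i then α.elim i c else β.elim i c := by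
  have h := isInd_ind (c := c) (p := p) v i α β
  have hself : ∀ b, c b ≠ i →
      τ (ind v i (some b) none) = if τ (port v) = i then c b else i := fun b hb =>
    (isInd_ind (c := c) (p := p) v i (some b) none).apply_eq_of_self hτ href hb
  by_cases hαβ : α.elim i c = β.elim i c
  · have := h.eq_or_eq hτ href
    grind
  by_cases hβ : β.elim i c = i
  · obtain _ | a := α
    · exact absurd hβ.symm hαβ
    · rw [hβ] at h hαβ ⊢
      exact h.apply_eq_of_self hτ href hαβ
  obtain _ | b := β
  · exact absurd rfl hβ
  by_cases hα : α.elim i c = i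
  · obtain ⟨d, hdb, hdi⟩ : ∃ d, d ≠ b ∧ c d ≠ i := by
      by_contra! hd
      have h1 := hd (b + 1) (by simp)
      have h2 := hd (b + 2) (by simp)
      have := hc (h1.trans h2.symm)
      simp at this
    rw [hα] at h ⊢
    exact (IsInd.apply_eq_of_triangle hτ href (hc.ne hdb.symm) hdi (Ne.symm hβ)
      (isInd_ind v i (some d) none) h (isInd_ind v i (some b) (some d)) (hself d hdi)).1
  · exact (IsInd.apply_eq_of_triangle hτ href hαβ hβ (Ne.symm hα)
      (isInd_ind v i (some b) none) (isInd_ind v i none α) h (hself b hβ)).2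

lemma apply_cmp (hc : Function.Injective c) (hτ : IsProperColoring (graph c p) τ)
    (href : ∀ i, τ (ref i) = i) (i j : Fin n) :
    τ (cmp i j) =
      if τ (port 0) = i then if τ (port 1) = j then c 2 else c 1 else c 0 := by
  have c01 : c 0 ≠ c 1 := hc.ne (by decide)
  have c02 : c 0 ≠ c 2 := hc.ne (by decide)
  have c12 : c 1 ≠ c 2 := hc.ne (by decide)
  have h1 : τ (cmp i j) ≠ τ (ind 0 i (some 0) (some 1)) := hτ fun a => by
    simp only [color, Option.elim]; grind
  have h2 : τ (cmp i j) ≠ τ (ind 0 i (some 0) (some 2)) := hτ fun a => by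
    simp only [color, Option.elim]; grind
  have h3 : τ (cmp i j) ≠ τ (ind 1 j (some 1) (some 2)) := hτ fun a => by
    simp only [color, Option.elim]; grind
  obtain ⟨a, ha⟩ := exists_color_eq hτ href (cmp i j)
  simp only [apply_ind hc hτ href, Option.elim] at h1 h2 h3
  simp only [color] at ha
  grind

lemma apply_half_both (hc : Function.Injective c) (hτ : IsProperColoring (graph c p) τ)
    (href : ∀ i, τ (ref i) = i) (i j : Fin n) :
    (τ (half i j) = if τ (port 0) = i ∧ τ (port 1) ≠ j then c 0 else c 1) ∧
      τ (both i j) = if τ (port 0) = i ∧ τ (port 1) = j then c 0 else c 2 := by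
  have c01 : c 0 ≠ c 1 := hc.ne (by decide)
  have c02 : c 0 ≠ c 2 := hc.ne (by decide)
  have c12 : c 1 ≠ c 2 := hc.ne (by decide)
  have h1 : τ (cmp i j) ≠ τ (half i j) := hτ fun a => by simp only [color]; grind
  have h2 : τ (cmp i j) ≠ τ (both i j) := hτ fun a => by simp only [color]; grind
  have h3 : τ (half i j) ≠ τ (both i j) := hτ fun a => by simp only [color]; grind
  have h4 := apply_cmp hc hτ href i j
  obtain ⟨a, ha⟩ := exists_color_eq hτ href (half i j)
  obtain ⟨b, hb⟩ := exists_color_eq hτ href (both i j)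
  simp only [color] at ha hb
  grind

/-- The intended colorings are the only proper ones, provided the colors of the first two
ports are independent and determine that of the third. -/
lemma exists_eq_color (hc : Function.Injective c)
    (hp : ∀ a b, ∃ d, p 0 d = p 0 a ∧ p 1 d = p 1 b)
    (hp' : ∀ a b, p 0 a = p 0 b → p 1 a = p 1 b → p 2 a = p 2 b)
    (hτ : IsProperColoring (graph c p) τ) (href : ∀ i, τ (ref i) = i) :
    ∃ a, τ = color c p a := by
  obtain ⟨a, ha⟩ := exists_color_eq hτ href (port 0)
  obtain ⟨b, hb⟩ := exists_color_eq hτ href (port 1)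
  obtain ⟨d, hda, hdb⟩ := hp a b
  have h0 : τ (port 0) = p 0 d := by rw [hda, ← ha, color]
  have h1 : τ (port 1) = p 1 d := by rw [hdb, ← hb, color]
  have c01 : c 0 ≠ c 1 := hc.ne (by decide)
  have c02 : c 0 ≠ c 2 := hc.ne (by decide)
  have c12 : c 1 ≠ c 2 := hc.ne (by decide)
  have h2 : τ (port 2) = p 2 d := by
    by_contra hne
    have h : τ (both (p 0 d) (p 1 d)) ≠ τ (ind 2 (τ (port 2)) (some 0) (some 1)) :=
      hτ fun e => by
        have := hp' e d
        simp only [color, Option.elim]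
        grind
    simp [(apply_half_both hc hτ href _ _).2, apply_ind hc hτ href, h0, h1] at h
  have hport : ∀ v, τ (port v) = p v d := by
    intro v
    fin_cases v <;> assumption
  refine ⟨d, funext fun u => ?_⟩
  cases u with
  | ref i => exact href i
  | port v => exact hport v
  | ind v i α β => simp only [apply_ind hc hτ href, hport, color]
  | cmp i j => simp only [apply_cmp hc hτ href, hport, color]
  | half i j => simp only [(apply_half_both hc hτ href i j).1, hport, color]
  | both i j => simp only [(apply_half_both hc hτ href i j).2, hport, color]

/-- An enumeration of the vertices by a sum of products of finite types. -/
def ofSum : Fin n ⊕ Fin 3 ⊕ (Fin 3 × Fin n × Option (Fin 3) × Option (Fin 3)) ⊕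
    (Fin n × Fin n) ⊕ (Fin n × Fin n) ⊕ (Fin n × Fin n) → OpVertex n
  | .inl i => ref i
  | .inr (.inl v) => port v
  | .inr (.inr (.inl (v, i, α, β))) => ind v i α β
  | .inr (.inr (.inr (.inl (i, j)))) => cmp i j
  | .inr (.inr (.inr (.inr (.inl (i, j))))) => half i j
  | .inr (.inr (.inr (.inr (.inr (i, j))))) => both i j

lemma ofSum_surjective : Function.Surjective (ofSum (n := n))
  | ref i => ⟨.inl i, rfl⟩
  | port v => ⟨.inr (.inl v), rfl⟩
  | ind v i α β => ⟨.inr (.inr (.inl (v, i, α, β))), rfl⟩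
  | cmp i j => ⟨.inr (.inr (.inr (.inl (i, j)))), rfl⟩
  | half i j => ⟨.inr (.inr (.inr (.inr (.inl (i, j))))), rfl⟩
  | both i j => ⟨.inr (.inr (.inr (.inr (.inr (i, j))))), rfl⟩

instance : Finite (OpVertex n) := .of_surjective _ ofSum_surjective

lemma card_le (hn : 3 ≤ n) : Nat.card (OpVertex n) ≤ 21 * n ^ 2 := by
  refine (Nat.card_le_card_of_surjective _ ofSum_surjective).trans ?_
  simp only [Nat.card_eq_fintype_card, Fintype.card_sum, Fintype.card_prod, Fintype.card_fin,
    Fintype.card_option]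
  nlinarith

end OpVertex

lemma SimpleGraph.card_edgeSet_le_card_sq {V : Type*} [Finite V] (G : SimpleGraph V) :
    Nat.card G.edgeSet ≤ Nat.card V ^ 2 := by
  classical
  have := Fintype.ofFinite V
  rw [Nat.card_eq_fintype_card, Nat.card_eq_fintype_card, ← SimpleGraph.edgeFinset_card]
  exact G.card_edgeFinset_le_card_choose_two.trans (Nat.choose_le_pow _ _)

open OpVertex in
/-- Every total binary operation on the symbols can be simulated with `O(n²)` vertices. -/
lemma exists_simulates_binary {m n : ℕ} (hm : 2 ≤ m) (hn : max m 3 ≤ n)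
    (f : (Fin 2 → Fin m) → Fin m) :
    ∃ (V : Type) (_ : Fintype V) (G : SimpleGraph V)
      (x : Fin 2 → V) (y : Fin 1 → V) (r : Fin n → V),
      Simulates G m n (fun a => some fun _ : Fin 1 => f a) x y r ∧
        Nat.card V ≤ 441 * n ^ 4 ∧ Nat.card G.edgeSet ≤ 441 * n ^ 5 := by
  obtain ⟨hmn, hn3⟩ := max_le_iff.1 hn
  have : NeZero m := ⟨by omega⟩
  set c : Fin 3 → Fin n := Fin.castLE hn3
  have hc : Function.Injective c := Fin.castLE_injective hn3
  set p : Fin 3 → (Fin 2 → Fin m) → Fin n :=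
    fun v a => Fin.castLE hmn (![a 0, a 1, f a] v) with hp_def
  have hp : ∀ a b, ∃ d, p 0 d = p 0 a ∧ p 1 d = p 1 b := fun a b =>
    ⟨![a 0, b 1], by simp [hp_def]⟩
  have hp' : ∀ a b, p 0 a = p 0 b → p 1 a = p 1 b → p 2 a = p 2 b := by
    intro a b h0 h1
    have : a = b := by
      funext k
      fin_cases k
      · exact Fin.castLE_injective hmn h0
      · exact Fin.castLE_injective hmn h1
    rw [this]
  have hval : ∀ a (j : Fin 2), (color c p a (port j.castSucc) : ℕ) = a j := by
    intro a j
    fin_cases j <;> rfl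
  have huniq {σ : OpVertex n → Fin n} {a : Fin 2 → Fin n} (hσ : IsProperColoring (graph c p) σ)
      (href : ∀ i, σ (ref i) = i) (hx : ∀ j : Fin 2, σ (port j.castSucc) = a j) :
      ∃ d, σ = color c p d ∧ ∀ j, (a j : ℕ) = d j := by
    obtain ⟨d, rfl⟩ := exists_eq_color hc hp hp' hσ href
    exact ⟨d, rfl, fun j => by rw [← hx, hval]⟩
  have hV := card_le hn3
  have hn1 : 1 ≤ n := by omega
  refine ⟨OpVertex n, Fintype.ofFinite _, graph c p, fun j => port j.castSucc,
    fun _ => port 2, ref, ⟨fun i j h => by injection h, ⟨_, isProperColoring_color 0⟩, ?_, ?_⟩,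
    ?_, ?_⟩
  · intro σ hσ i j hij
    by_contra hne
    exact hσ (show (graph c p).Adj (ref i) (ref j) from fun _ => hne) hij
  · intro a
    refine ⟨⟨?_, ?_⟩, ?_, ?_⟩
    · rintro ⟨σ, hσ, href, hx⟩
      obtain ⟨d, -, hd⟩ := huniq hσ href hx
      exact ⟨d, hd, rfl⟩
    · rintro ⟨d, hd, -⟩
      exact ⟨color c p d, isProperColoring_color d, fun _ => rfl, fun j => Fin.ext <| by
        rw [hval, hd]⟩
    · intro σ τ hσ hτ hσr hτr hσx hτx
      obtain ⟨d, rfl, hd⟩ := huniq hσ hσr hσx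
      obtain ⟨e, rfl, he⟩ := huniq hτ hτr hτx
      rw [show d = e from funext fun j => Fin.ext <| by rw [← hd, he]]
    · intro σ hσ href hx a' b ha' hb k
      obtain ⟨d, rfl, hd⟩ := huniq hσ href hx
      obtain rfl : d = a' := funext fun j => Fin.ext <| by rw [← hd, ha']
      obtain rfl := Option.some.inj hb
      rfl
  · calc Nat.card (OpVertex n) ≤ 21 * n ^ 2 := hV
      _ ≤ 441 * n ^ 4 := Nat.mul_le_mul (by norm_num) (Nat.pow_le_pow_right hn1 (by norm_num))
  · calc Nat.card (graph c p).edgeSet ≤ Nat.card (OpVertex n) ^ 2 :=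
          SimpleGraph.card_edgeSet_le_card_sq _
      _ ≤ (21 * n ^ 2) ^ 2 := Nat.pow_le_pow_left hV 2
      _ = 441 * n ^ 4 := by ring
      _ ≤ 441 * n ^ 5 := Nat.mul_le_mul_left _ (Nat.pow_le_pow_right hn1 (by norm_num))

/-- There is a constant `c > 0` such that for all `m ≥ 2` and `n ≥ max(m,3)`, the total
functions `add_m(x,y) = x + y (mod m)` and `sub_m(x,y) = x − y (mod m)` on `S²` can each
be simulated through `n`-colorings by a finite simple graph with at most `c·n⁴` vertices
and `c·n⁵` edges. -/
theorem statement12 :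
    ∃ c : ℕ, 0 < c ∧
      ∀ m n : ℕ, (hm : 2 ≤ m) → max m 3 ≤ n →
        -- add_m
        (∃ (V : Type) (_ : Fintype V) (G : SimpleGraph V)
            (x : Fin 2 → V) (y : Fin 1 → V) (r : Fin n → V),
          Simulates G m n
            (fun a : Fin 2 → Fin m => some fun _ : Fin 1 =>
              (⟨((a 0 : ℕ) + (a 1 : ℕ)) % m, Nat.mod_lt _ (by omega)⟩ : Fin m))
            x y r ∧
          Nat.card V ≤ c * n ^ 4 ∧ Nat.card G.edgeSet ≤ c * n ^ 5) ∧
        -- sub_m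
        (∃ (V : Type) (_ : Fintype V) (G : SimpleGraph V)
            (x : Fin 2 → V) (y : Fin 1 → V) (r : Fin n → V),
          Simulates G m n
            (fun a : Fin 2 → Fin m => some fun _ : Fin 1 =>
              (⟨((a 0 : ℕ) + m - (a 1 : ℕ)) % m, Nat.mod_lt _ (by omega)⟩ : Fin m))
            x y r ∧
          Nat.card V ≤ c * n ^ 4 ∧ Nat.card G.edgeSet ≤ c * n ^ 5) := by
  exact ⟨441, by norm_num, fun m n hm hn =>
    ⟨exists_simulates_binary hm hn _, exists_simulates_binary hm hn _⟩⟩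
end

section
/- There is a constant c > 0 such that for all integers m ≥ 2, n ≥ max(m,3) and r ≥ 1, the generalized-edge partial function Edg_r : S^{2r} ⇀ S^r — defined exactly on pairs (u,v) of vectors u, v ∈ S^r with u ≠ v, with value Edg_r(u,v) = v — can be simulated through n-colorings by a finite simple graph with at most c·r·n⁴ vertices and at most c·r·n⁵ edges, in which the q = r output vertices coincide with the r input vertices carrying the second block v of the input. -/
namespace ConstraintGraph

variable {X J : Type} {n : ℕ}

/-- Indices of the star gadgets: one for every variable and every base color among three
distinguished ones, and one more for every leaf of these. -/
abbrev StarIndex (X : Type) (n : ℕ) : Type := (X × Fin 3) ⊕ (X × Fin 3 × Fin n)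

/-- Vertices: references, variables, and the leaves of the star gadgets. -/
abbrev Vertex (X : Type) (n : ℕ) : Type := Fin n ⊕ X ⊕ (StarIndex X n × Fin n)

/-- The reference vertex of a color. -/
abbrev ref (i : Fin n) : Vertex X n := Sum.inl i

/-- The vertex of a variable. -/
abbrev var (x : X) : Vertex X n := Sum.inr (Sum.inl x)

/-- The leaf of color `c` in the star gadget `t`. -/
abbrev leaf (t : StarIndex X n) (c : Fin n) : Vertex X n := Sum.inr (Sum.inr (t, c))

/-- The vertex at the center of a star gadget. -/
def center : StarIndex X n → Vertex X n
  | .inl (x, _) => var x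
  | .inr (x, b, c) => leaf (.inl (x, b)) c

/-- The base color of a star gadget. -/
def base (z : Fin 3 → Fin n) : StarIndex X n → Fin n
  | .inl (_, b) => z b
  | .inr _ => z 0

/-- A vertex colored `z 0` if the variable `x` has color `a`, and `z i` otherwise. -/
def indicator (z : Fin 3 → Fin n) (i : Fin 3) (x : X) (a : Fin n) : Vertex X n :=
  if a = z i then leaf (.inl (x, 0)) (z i) else leaf (.inr (x, i, a)) (z i)

/-- The generating adjacencies of the graph of a binary constraint system, where `F j` is the
relation forbidden between the variables `src j` and `tgt j`. -/
inductive Link (z : Fin 3 → Fin n) (src tgt : J → X) (F : J → Fin n → Fin n → Prop) :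
    Vertex X n → Vertex X n → Prop
  | refs {i j : Fin n} (h : i ≠ j) : Link z src tgt F (ref i) (ref j)
  | list {t : StarIndex X n} {c d : Fin n} (hb : d ≠ base z t) (hc : d ≠ c) :
      Link z src tgt F (leaf t c) (ref d)
  | spoke {t : StarIndex X n} {c : Fin n} (hc : c ≠ base z t) :
      Link z src tgt F (leaf t c) (center t)
  | leaves {t : StarIndex X n} {c d : Fin n} (hc : c ≠ base z t) (hd : d ≠ base z t)
      (h : c ≠ d) : Link z src tgt F (leaf t c) (leaf t d)
  | forbid {j : J} {a b : Fin n} (h : F j a b) :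
      Link z src tgt F (indicator z 1 (src j) a) (indicator z 2 (tgt j) b)

/-- The graph of a binary constraint system. -/
def graph (z : Fin 3 → Fin n) (src tgt : J → X) (F : J → Fin n → Fin n → Prop) :
    SimpleGraph (Vertex X n) :=
  SimpleGraph.fromRel (Link z src tgt F)

/-- The color of the center of a star gadget under an assignment. -/
def centerColor (z : Fin 3 → Fin n) (f : X → Fin n) : StarIndex X n → Fin n
  | .inl (x, _) => f x
  | .inr (x, b, c) => if f x = c then z b else c

/-- The coloring that extends an assignment. -/
def extend (z : Fin 3 → Fin n) (f : X → Fin n) : Vertex X n → Fin n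
  | .inl i => i
  | .inr (.inl x) => f x
  | .inr (.inr (t, c)) => if centerColor z f t = c then base z t else c

variable {z : Fin 3 → Fin n} {src tgt : J → X} {F : J → Fin n → Fin n → Prop}

theorem extend_center (f : X → Fin n) (t : StarIndex X n) :
    extend z f (center t) = centerColor z f t := by
  rcases t with ⟨x, b⟩ | ⟨x, b, c⟩ <;> rfl

theorem extend_indicator (hz : Function.Injective z) (f : X → Fin n) {i : Fin 3} (hi : i ≠ 0)
    (x : X) (a : Fin n) :
    extend z f (indicator z i x a) = if f x = a then z 0 else z i := by
  have : z i ≠ z 0 := fun h => hi (hz h)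
  unfold indicator
  split_ifs <;> simp_all [extend, centerColor, base]

theorem Link.ne (hz : Function.Injective z) {u v : Vertex X n} (h : Link z src tgt F u v) :
    u ≠ v := by
  have : z 1 ≠ z 2 := fun h => by simpa using hz h
  cases h with
  | refs h => simpa using h
  | list => simp
  | @spoke t => rcases t with ⟨x, b⟩ | ⟨x, b, c⟩ <;> simp [center]
  | leaves _ _ h => simpa using h
  | forbid => unfold indicator; split_ifs <;> simp [this]

theorem isProperColoring_iff (hz : Function.Injective z) (σ : Vertex X n → Fin n) :
    IsProperColoring (graph z src tgt F) σ ↔ ∀ u v, Link z src tgt F u v → σ u ≠ σ v := by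
  constructor
  · intro h u v huv
    exact h ((SimpleGraph.fromRel_adj _ _ _).2 ⟨huv.ne hz, .inl huv⟩)
  · intro h u v huv
    obtain ⟨-, huv | huv⟩ := (SimpleGraph.fromRel_adj _ _ _).1 huv
    exacts [h _ _ huv, (h _ _ huv).symm]

theorem isProperColoring_extend (hz : Function.Injective z) {f : X → Fin n}
    (hf : ∀ j, ¬ F j (f (src j)) (f (tgt j))) :
    IsProperColoring (graph z src tgt F) (extend z f) := by
  rw [isProperColoring_iff hz]
  intro u v h
  have h1 : z 1 ≠ z 0 := fun h => by simpa using hz h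
  have h2 : z 2 ≠ z 0 := fun h => by simpa using hz h
  have h12 : z 1 ≠ z 2 := fun h => by simpa using hz h
  cases h with
  | refs h => exact h
  | list hb hc => simp only [extend]; split_ifs <;> [exact hb.symm; exact hc.symm]
  | spoke hc => rw [extend_center]; simp only [extend]; split_ifs <;> grind
  | leaves hc hd h => simp only [extend]; split_ifs <;> grind
  | @forbid j a b h =>
    rw [extend_indicator hz f (by decide), extend_indicator hz f (by decide)]
    split_ifs with ha hb
    · subst ha hb
      exact absurd h (hf j)
    · exact h2.symm
    · exact h1
    · exact h12

theorem leaf_color (hz : Function.Injective z) {σ : Vertex X n → Fin n}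
    (hσ : IsProperColoring (graph z src tgt F) σ) (hr : ∀ i, σ (ref i) = i)
    (t : StarIndex X n) (c : Fin n) :
    σ (leaf t c) = if σ (center t) = c then base z t else c := by
  rw [isProperColoring_iff hz] at hσ
  have hlist (c : Fin n) : σ (leaf t c) = base z t ∨ σ (leaf t c) = c := by
    by_contra! h
    exact hσ _ _ (.list h.1 h.2) (hr _).symm
  have hspoke (c : Fin n) (hc : c ≠ base z t) := hσ _ _ (.spoke (t := t) hc)
  have hleaves (c d : Fin n) (hc : c ≠ base z t) (hd : d ≠ base z t) (h : c ≠ d) :=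
    hσ _ _ (.leaves hc hd h)
  have := hlist (σ (center t))
  split_ifs <;> grind

theorem eq_extend (hz : Function.Injective z) {σ : Vertex X n → Fin n}
    (hσ : IsProperColoring (graph z src tgt F) σ) (hr : ∀ i, σ (ref i) = i) :
    σ = extend z fun x => σ (var x) := by
  have hc (t : StarIndex X n) : σ (center t) = centerColor z (fun x => σ (var x)) t := by
    rcases t with ⟨x, b⟩ | ⟨x, b, c⟩
    · rfl
    · exact leaf_color hz hσ hr _ _
  ext1 v
  rcases v with i | x | ⟨t, c⟩
  · exact hr i
  · rfl
  · exact (leaf_color hz hσ hr t c).trans (by rw [hc]; rfl)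

theorem not_forbidden (hz : Function.Injective z) {σ : Vertex X n → Fin n}
    (hσ : IsProperColoring (graph z src tgt F) σ) (hr : ∀ i, σ (ref i) = i) (j : J) :
    ¬ F j (σ (var (src j))) (σ (var (tgt j))) := by
  intro h
  have key := (isProperColoring_iff hz σ).1 hσ _ _ (.forbid h)
  rw [eq_extend hz hσ hr, extend_indicator hz _ (by decide),
    extend_indicator hz _ (by decide)] at key
  simp [extend] at key

theorem injective_ref (hz : Function.Injective z) {σ : Vertex X n → Fin n}
    (hσ : IsProperColoring (graph z src tgt F) σ) :
    Function.Injective fun i : Fin n => σ (ref i) := by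
  intro i j h
  by_contra hij
  exact (isProperColoring_iff hz σ).1 hσ _ _ (.refs hij) h

theorem card_vertex [Fintype X] :
    Nat.card (Vertex X n) =
      n + Nat.card X + (Nat.card X * 3 + Nat.card X * 3 * n) * n := by
  simp only [Nat.card_eq_fintype_card, Fintype.card_sum, Fintype.card_prod, Fintype.card_fin]
  ring

/-- Two ends for each possible generating adjacency. -/
def linkEnds (z : Fin 3 → Fin n) (src tgt : J → X) :
    (Fin n × Fin n) ⊕ (StarIndex X n × Fin n × Fin n) ⊕ (StarIndex X n × Fin n) ⊕
      (StarIndex X n × Fin n × Fin n) ⊕ (J × Fin n × Fin n) → Sym2 (Vertex X n)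
  | .inl (i, j) => s(ref i, ref j)
  | .inr (.inl (t, c, d)) => s(leaf t c, ref d)
  | .inr (.inr (.inl (t, c))) => s(leaf t c, center t)
  | .inr (.inr (.inr (.inl (t, c, d)))) => s(leaf t c, leaf t d)
  | .inr (.inr (.inr (.inr (j, a, b)))) => s(indicator z 1 (src j) a, indicator z 2 (tgt j) b)

theorem Link.mem_range {u v : Vertex X n} (h : Link z src tgt F u v) :
    s(u, v) ∈ Set.range (linkEnds z src tgt) := by
  cases h with
  | @refs i j => exact ⟨.inl (i, j), rfl⟩
  | @list t c d => exact ⟨.inr (.inl (t, c, d)), rfl⟩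
  | @spoke t c => exact ⟨.inr (.inr (.inl (t, c))), rfl⟩
  | @leaves t c d => exact ⟨.inr (.inr (.inr (.inl (t, c, d)))), rfl⟩
  | @forbid j a b => exact ⟨.inr (.inr (.inr (.inr (j, a, b)))), rfl⟩

theorem card_edgeSet_le [Fintype X] [Fintype J] :
    Nat.card (graph z src tgt F).edgeSet ≤
      n * n + (Nat.card X * 3 + Nat.card X * 3 * n) * (2 * n * n + n) + Nat.card J * n * n := by
  have hsub : (graph z src tgt F).edgeSet ⊆ Set.range (linkEnds z src tgt) := by
    intro e he
    induction e with | _ u v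
    obtain ⟨-, h | h⟩ := (SimpleGraph.fromRel_adj _ _ _).1 he
    · exact h.mem_range
    · rw [Sym2.eq_swap]
      exact h.mem_range
  refine (Nat.card_mono (Set.finite_range _) hsub).trans ((Finite.card_range_le _).trans ?_)
  simp only [Nat.card_eq_fintype_card, Fintype.card_sum, Fintype.card_prod, Fintype.card_fin]
  apply le_of_eq
  ring

end ConstraintGraph

namespace GeneralizedEdge

open ConstraintGraph

variable {m n r : ℕ}

/-- Position of an entry of the first block of the input. -/
def fstIdx (j : Fin r) : Fin (2 * r) := Fin.castLE (by omega) j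

/-- Position of an entry of the second block of the input. -/
def sndIdx (j : Fin r) : Fin (2 * r) := ⟨r + (j : ℕ), by have := j.isLt; omega⟩

/-- Variables: the input, a local comparison for every coordinate and color, and a running
record of whether a difference was found. -/
abbrev Var (n r : ℕ) : Type := Fin (2 * r) ⊕ Fin (r * n) ⊕ Fin (r * n + 1)

/-- Constraints: initial and final record, input symbols, and four for each comparison. -/
abbrev Con (n r : ℕ) : Type := Unit ⊕ Fin (2 * r) ⊕ (Fin 4 × Fin (r * n))

/-- First variable of a constraint. -/
def src : Con n r → Var n r
  | .inl _ => .inr (.inr 0)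
  | .inr (.inl i) => .inl i
  | .inr (.inr (0, k)) => .inl (fstIdx k.divNat)
  | .inr (.inr (1, k)) => .inl (sndIdx k.divNat)
  | .inr (.inr (2, k)) => .inr (.inr k.castSucc)
  | .inr (.inr (3, k)) => .inr (.inl k)

/-- Second variable of a constraint. -/
def tgt : Con n r → Var n r
  | .inl _ => .inr (.inr (Fin.last _))
  | .inr (.inl i) => .inl i
  | .inr (.inr (0, k)) => .inr (.inl k)
  | .inr (.inr (1, k)) => .inr (.inl k)
  | .inr (.inr (2, k)) => .inr (.inr k.succ)
  | .inr (.inr (3, k)) => .inr (.inr k.succ)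

/-- The relation required by a constraint. -/
def Allowed (m : ℕ) (z : Fin 3 → Fin n) : Con n r → Fin n → Fin n → Prop
  | .inl _, p, q => p = z 0 ∧ q ≠ z 0
  | .inr (.inl _), p, _ => (p : ℕ) < m
  | .inr (.inr (0, k)), u, e => if u = k.modNat then e = z 0 ∨ e = z 2 else e = z 1
  | .inr (.inr (1, k)), v, e => (e = z 2 → v ≠ k.modNat) ∧ (e = z 0 → v = k.modNat)
  | .inr (.inr (2, _)), p, q => if p = z 0 then q = z 0 ∨ q = z 2 else q = z 1
  | .inr (.inr (3, _)), e, q => (q = z 2 → e = z 2) ∧ (q = z 0 → e ≠ z 2)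

/-- The comparison `k` detects that the two blocks differ. -/
def Detects (a : Fin (2 * r) → Fin n) (k : Fin (r * n)) : Prop :=
  a (fstIdx k.divNat) = k.modNat ∧ a (sndIdx k.divNat) ≠ k.modNat

theorem exists_detects_iff (a : Fin (2 * r) → Fin n) :
    (∃ k, Detects a k) ↔ ∃ j, a (fstIdx j) ≠ a (sndIdx j) := by
  constructor
  · rintro ⟨k, h1, h2⟩
    exact ⟨k.divNat, by rw [h1]; exact h2.symm⟩
  · rintro ⟨j, h⟩
    have hk := finProdFinEquiv.symm_apply_apply (j, a (fstIdx j))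
    have hd : (finProdFinEquiv (j, a (fstIdx j))).divNat = j := congrArg Prod.fst hk
    have hm : (finProdFinEquiv (j, a (fstIdx j))).modNat = a (fstIdx j) := congrArg Prod.snd hk
    refine ⟨finProdFinEquiv (j, a (fstIdx j)), ?_, ?_⟩
    · rw [hd, hm]
    · rw [hd, hm]; exact h.symm

open Classical in
/-- The color of a local comparison. -/
noncomputable def compareColor (z : Fin 3 → Fin n) (a : Fin (2 * r) → Fin n)
    (k : Fin (r * n)) : Fin n :=
  if a (fstIdx k.divNat) = k.modNat then if a (sndIdx k.divNat) = k.modNat then z 0 else z 2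
  else z 1

open Classical in
/-- The color of the running record. -/
noncomputable def recordColor (z : Fin 3 → Fin n) (a : Fin (2 * r) → Fin n) : ℕ → Fin n
  | 0 => z 0
  | k + 1 =>
    if recordColor z a k = z 0 then if ∃ h : k < r * n, Detects a ⟨k, h⟩ then z 2 else z 0
    else z 1

variable {z : Fin 3 → Fin n}

theorem compareColor_eq_iff (hz : Function.Injective z) (a : Fin (2 * r) → Fin n)
    (k : Fin (r * n)) : compareColor z a k = z 2 ↔ Detects a k := by
  have h02 : z 0 ≠ z 2 := fun h => by simpa using hz h
  have h12 : z 1 ≠ z 2 := fun h => by simpa using hz h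
  unfold compareColor Detects
  split_ifs <;> simp_all

theorem recordColor_ne_iff (hz : Function.Injective z) (a : Fin (2 * r) → Fin n) (K : ℕ) :
    recordColor z a K ≠ z 0 ↔ ∃ k, Detects a k ∧ (k : ℕ) < K := by
  have h2 : z 2 ≠ z 0 := fun h => by simpa using hz h
  have h1 : z 1 ≠ z 0 := fun h => by simpa using hz h
  induction K with
  | zero => simp [recordColor]
  | succ K ih =>
    rw [recordColor]
    by_cases h : recordColor z a K = z 0
    · have hK : ¬ ∃ k, Detects a k ∧ (k : ℕ) < K := fun h' => ih.2 h' h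
      rw [if_pos h]
      constructor
      · intro h'
        by_cases hd : ∃ h : K < r * n, Detects a ⟨K, h⟩
        · obtain ⟨hlt, hd⟩ := hd
          exact ⟨⟨K, hlt⟩, hd, Nat.lt_succ_self K⟩
        · simp [hd] at h'
      · rintro ⟨k, hk, hlt⟩
        have hkK : (k : ℕ) = K := by
          by_contra hne
          exact hK ⟨k, hk, by omega⟩
        have hd : ∃ h : K < r * n, Detects a ⟨K, h⟩ := by
          subst hkK
          exact ⟨k.isLt, hk⟩
        rwa [if_pos hd]
    · rw [if_neg h]
      obtain ⟨k, hk, hlt⟩ := ih.1 h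
      exact ⟨fun _ => ⟨k, hk, by omega⟩, fun _ => h1⟩

/-- The only assignment satisfying the constraints for a given input, if there is one. -/
noncomputable def assignment (z : Fin 3 → Fin n) (a : Fin (2 * r) → Fin n) : Var n r → Fin n
  | .inl i => a i
  | .inr (.inl k) => compareColor z a k
  | .inr (.inr k) => recordColor z a k

theorem allowed_iff (hz : Function.Injective z) (f : Var n r → Fin n) :
    (∀ j, Allowed m z j (f (src j)) (f (tgt j))) ↔
      (∀ i, (f (.inl i) : ℕ) < m) ∧ (∃ j, f (.inl (fstIdx j)) ≠ f (.inl (sndIdx j))) ∧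
        f = assignment z fun i => f (.inl i) := by
  have h01 : z 0 ≠ z 1 := fun h => by simpa using hz h
  have h02 : z 0 ≠ z 2 := fun h => by simpa using hz h
  have h12 : z 1 ≠ z 2 := fun h => by simpa using hz h
  have hlast (a : Fin (2 * r) → Fin n) :
      recordColor z a (r * n) ≠ z 0 ↔ ∃ j, a (fstIdx j) ≠ a (sndIdx j) := by
    rw [recordColor_ne_iff hz, ← exists_detects_iff]
    exact exists_congr fun k => and_iff_left k.isLt
  classical
  constructor
  · intro h
    have hcmp (k : Fin (r * n)) :
        f (.inr (.inl k)) = compareColor z (fun i => f (.inl i)) k := by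
      have h0 := h (.inr (.inr (0, k)))
      have h1 := h (.inr (.inr (1, k)))
      simp only [Allowed, src, tgt] at h0 h1
      unfold compareColor
      split_ifs at h0 ⊢ <;> grind
    have hrec (k : ℕ) (hk : k < r * n + 1) :
        f (.inr (.inr ⟨k, hk⟩)) = recordColor z (fun i => f (.inl i)) k := by
      induction k with
      | zero => exact (h (.inl ())).1
      | succ k ih =>
        have hk' : k < r * n := by omega
        have h2 := h (.inr (.inr (2, ⟨k, hk'⟩)))
        have h3 := h (.inr (.inr (3, ⟨k, hk'⟩)))
        have hd := compareColor_eq_iff hz (fun i => f (.inl i)) ⟨k, hk'⟩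
        simp only [Allowed, src, tgt, Fin.castSucc_mk, Fin.succ_mk, ih, hcmp, hd] at h2 h3
        rw [recordColor]
        simp only [hk', exists_true_left]
        split_ifs at h2 ⊢ <;> grind
    have hf : f = assignment z fun i => f (.inl i) := by
      ext1 v
      rcases v with i | k | k
      exacts [rfl, hcmp k, hrec k k.isLt]
    refine ⟨fun i => h (.inr (.inl i)), ?_, hf⟩
    rw [← hlast fun i => f (.inl i), ← hrec (r * n) (by omega)]
    exact (h (.inl ())).2
  · rintro ⟨hm, hne, hf⟩
    generalize ha : (fun i => f (.inl i)) = a at hf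
    subst hf
    rintro (_ | i | ⟨t, k⟩)
    · exact ⟨rfl, (hlast a).2 hne⟩
    · exact hm i
    · have hd := compareColor_eq_iff hz a k
      fin_cases t
      · simp only [Allowed, src, tgt, assignment, compareColor]
        split_ifs <;> simp
      · simp only [Allowed, src, tgt, assignment, compareColor]
        split_ifs <;> grind
      · simp only [Allowed, src, tgt, assignment, Fin.val_castSucc, Fin.val_succ, recordColor]
        split_ifs <;> simp
      · simp only [Allowed, src, tgt, assignment, Fin.val_succ, recordColor, hd, Fin.eta,
          Fin.is_lt, exists_true_left]
        split_ifs <;> grind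

theorem card_var_le (hn : 3 ≤ n) (hr : 1 ≤ r) : Nat.card (Var n r) ≤ 4 * (r * n) := by
  simp only [Nat.card_eq_fintype_card, Fintype.card_sum, Fintype.card_fin]
  nlinarith

theorem card_con_le (hn : 3 ≤ n) (hr : 1 ≤ r) : Nat.card (Con n r) ≤ 6 * (r * n) := by
  simp only [Nat.card_eq_fintype_card, Fintype.card_sum, Fintype.card_prod, Fintype.card_fin,
    Fintype.card_unit]
  nlinarith

theorem card_starIndex_le (hn : 3 ≤ n) (hr : 1 ≤ r) :
    Nat.card (Var n r) * 3 + Nat.card (Var n r) * 3 * n ≤ 24 * (r * n ^ 2) := by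
  have hX := card_var_le hn hr
  calc _ ≤ Nat.card (Var n r) * 3 * n + Nat.card (Var n r) * 3 * n := by
        gcongr
        exact Nat.le_mul_of_pos_right _ (by omega)
    _ ≤ 4 * (r * n) * 3 * n + 4 * (r * n) * 3 * n := by gcongr
    _ = 24 * (r * n ^ 2) := by ring

theorem card_vertex_le (hn : 3 ≤ n) (hr : 1 ≤ r) :
    Nat.card (Vertex (Var n r) n) ≤ 100 * r * n ^ 4 := by
  have hn1 : 1 ≤ n := by omega
  rw [card_vertex]
  calc _ ≤ r * n ^ 1 + 4 * (r * n ^ 1) + 24 * (r * n ^ 2) * n := by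
        gcongr
        · simpa using Nat.le_mul_of_pos_left n hr
        · simpa using card_var_le hn hr
        · exact card_starIndex_le hn hr
    _ = r * n ^ 1 + 4 * (r * n ^ 1) + 24 * (r * n ^ 3) := by ring
    _ ≤ r * n ^ 4 + 4 * (r * n ^ 4) + 24 * (r * n ^ 4) := by gcongr <;> omega
    _ ≤ 100 * r * n ^ 4 := by nlinarith [Nat.zero_le (r * n ^ 4)]

theorem card_edgeSet_graph_le (hn : 3 ≤ n) (hr : 1 ≤ r)
    (F : Con n r → Fin n → Fin n → Prop) :
    Nat.card (graph z src tgt F).edgeSet ≤ 100 * r * n ^ 5 := by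
  have hn1 : 1 ≤ n := by omega
  refine card_edgeSet_le.trans ?_
  calc _ ≤ r * n * n + 24 * (r * n ^ 2) * (2 * n * n + n * n) + 6 * (r * n) * n * n := by
        gcongr
        · exact Nat.le_mul_of_pos_left _ hr
        · exact card_starIndex_le hn hr
        · exact Nat.le_mul_of_pos_left _ hn1
        · exact card_con_le hn hr
    _ = r * n ^ 2 + 72 * (r * n ^ 4) + 6 * (r * n ^ 3) := by ring
    _ ≤ r * n ^ 5 + 72 * (r * n ^ 5) + 6 * (r * n ^ 5) := by gcongr <;> omega
    _ ≤ 100 * r * n ^ 5 := by nlinarith [Nat.zero_le (r * n ^ 5)]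

end GeneralizedEdge

open ConstraintGraph GeneralizedEdge in
/-- There is a constant `c > 0` such that for all `m ≥ 2`, `n ≥ max(m,3)` and `r ≥ 1`, the
generalized-edge partial function `Edg_r : S^{2r} ⇀ S^r` — defined exactly on pairs
`(u,v)` of `r`-vectors with `u ≠ v`, with value `v` — can be simulated through
`n`-colorings by a finite simple graph with at most `c·r·n⁴` vertices and `c·r·n⁵` edges,
in which the `r` output vertices coincide with the input vertices carrying `v`. -/
theorem statement13 :
    ∃ c : ℕ, 0 < c ∧
      ∀ m n r : ℕ, (hm : 2 ≤ m) → max m 3 ≤ n → 1 ≤ r →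
        ∃ (V : Type) (_ : Fintype V) (G : SimpleGraph V)
          (x : Fin (2 * r) → V) (y : Fin r → V) (rr : Fin n → V),
          Simulates G m n
            (fun a : Fin (2 * r) → Fin m =>
              if (fun j : Fin r => a (Fin.castLE (by omega) j)) =
                  (fun j : Fin r => a ⟨r + (j : ℕ), by have := j.isLt; omega⟩) then
                none
              else
                some fun j : Fin r => a ⟨r + (j : ℕ), by have := j.isLt; omega⟩)
            x y rr ∧
          (∀ j : Fin r, y j = x ⟨r + (j : ℕ), by have := j.isLt; omega⟩) ∧
          Nat.card V ≤ c * r * n ^ 4 ∧ Nat.card G.edgeSet ≤ c * r * n ^ 5 := by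
  refine ⟨100, by norm_num, fun m n r hm hn hr => ?_⟩
  have hn3 : 3 ≤ n := le_of_max_le_right hn
  let z : Fin 3 → Fin n := Fin.castLE hn3
  have hz : Function.Injective z := Fin.castLE_injective hn3
  let F : Con n r → Fin n → Fin n → Prop := fun j p q => ¬ Allowed m z j p q
  have hsat (σ : Vertex (Var n r) n → Fin n)
      (hσ : IsProperColoring (graph z src tgt F) σ) (h : ∀ i, σ (ref i) = i) :=
    (allowed_iff (m := m) hz fun x => σ (var x)).1
      fun j => not_not.1 (not_forbidden hz hσ h j)
  have hext (a : Fin (2 * r) → Fin n) (ha : ∀ i, (a i : ℕ) < m)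
      (hne : ∃ j, a (fstIdx j) ≠ a (sndIdx j)) :
      IsProperColoring (graph z src tgt F) (extend z (assignment z a)) :=
    isProperColoring_extend hz fun j =>
      not_not.2 ((allowed_iff (m := m) hz (assignment z a)).2 ⟨ha, hne, rfl⟩ j)
  refine ⟨Vertex (Var n r) n, inferInstance, graph z src tgt F, fun i => var (.inl i),
    fun j => var (.inl (sndIdx j)), ref, ⟨Sum.inl_injective, ?_, ?_, ?_⟩, fun j => rfl, ?_, ?_⟩
  · refine ⟨_, hext (fun i => if (i : ℕ) < r then z 0 else z 1) ?_ ⟨⟨0, hr⟩, ?_⟩⟩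
    · intro i
      split_ifs <;> simp [z] <;> omega
    · have : z 0 ≠ z 1 := fun h => by simpa using hz h
      simpa [fstIdx, sndIdx, show 0 < r from hr] using this
  · exact fun σ hσ => injective_ref hz hσ
  · intro a
    refine ⟨⟨?_, ?_⟩, ?_, ?_⟩
    · rintro ⟨σ, hσ, h, ha⟩
      obtain ⟨hlt, ⟨j, hj⟩, -⟩ := hsat σ hσ h
      simp only [ha] at hlt hj
      refine ⟨fun i => ⟨a i, hlt i⟩, fun _ => rfl, ?_⟩
      beta_reduce
      rw [if_neg fun h => hj (Fin.ext (Fin.mk.inj (congrFun h j)))]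
      rfl
    · rintro ⟨a', ha, hsome⟩
      have hne : ∃ j, a (fstIdx j) ≠ a (sndIdx j) := by
        by_contra! h
        beta_reduce at hsome
        rw [if_pos] at hsome
        · simp at hsome
        · funext j
          have := congrArg Fin.val (h j)
          rw [ha, ha] at this
          exact Fin.ext this
      exact ⟨_, hext a (fun i => (ha i).symm ▸ (a' i).isLt) hne, fun _ => rfl, fun _ => rfl⟩
    · intro σ τ hσ hτ h h' ha ha'
      rw [eq_extend hz hσ h, eq_extend hz hτ h', (hsat σ hσ h).2.2, (hsat τ hτ h').2.2]
      simp only [ha, ha']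
    · intro σ _ _ ha a' b haa' hb k
      beta_reduce at hb ha ⊢
      split_ifs at hb
      obtain rfl := Option.some.inj hb
      rw [ha]
      exact haa' _
  · exact card_vertex_le hn3 hr
  · exact card_edgeSet_graph_le hn3 hr F
end
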